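/- Let r, A > 0, d ≥ 2, and let f ∈ C^{0,1}([0,A]) be non-increasing on [0,A]. Then any Hölder continuous viscosity solution u of Ψ(−Δ)u = f(u) in ℝ^d∖closure(B_r(0)) with u = A in closure(B_r(0)), 0 ≤ u ≤ A on ℝ^d and lim_{|x|→∞} u(x) = 0 is radially symmetric and strictly decreasing in the radial direction. -/

import Mathlib

open MeasureTheory Set Filter Metric Asymptotics
open scoped RealInnerProductSpace ENNReal Topology NNReal

noncomputable section

abbrev Rd (d : ℕ) := EuclideanSpace ℝ (Fin d)

/-- The data of a Bernstein function `Ψ` vanishing at `0`, its Lévy measure `𝔪`,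
and the weak scaling conditions. -/
structure PsiSetting (d : ℕ) where
  Ψ : ℝ → ℝ
  m : Measure ℝ
  m_onIoi : m (Set.Iic 0) = 0
  smooth : ContDiffOn ℝ (⊤ : ℕ∞) Ψ (Set.Ioi 0)
  nonneg : ∀ x > (0:ℝ), 0 ≤ Ψ x
  deriv_alt : ∀ n : ℕ, ∀ x > (0:ℝ),
    (-1 : ℝ) ^ (n + 1) * iteratedDerivWithin (n + 1) Ψ (Set.Ioi 0) x ≤ 0
  zero_lim : Filter.Tendsto Ψ (nhdsWithin 0 (Set.Ioi 0)) (nhds 0)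
  levy_rep : ∀ lam > (0:ℝ), Ψ lam = ∫ t, (1 - Real.exp (-lam * t)) ∂m
  a₁ : ℝ
  a₂ : ℝ
  b₁ : ℝ
  b₂ : ℝ
  ha₁ : 0 < a₁
  ha₁₂ : a₁ ≤ a₂
  ha₂ : a₂ < 1
  hb₁ : 1 ≤ b₁
  hb₂ : 1 < b₂
  scaling_lower : ∀ r R : ℝ, 1 ≤ r → r ≤ R → (1 / b₁) * (R / r) ^ a₁ ≤ Ψ R / Ψ r
  scaling_upper : ∀ r R : ℝ, 1 ≤ r → r ≤ R → Ψ R / Ψ r ≤ b₁ * (R / r) ^ a₂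

/-- The jump kernel `j(r) = ∫_0^∞ (4πt)^{-d/2} e^{-r²/(4t)} 𝔪(dt)`. -/
def PsiSetting.j {d : ℕ} (S : PsiSetting d) (r : ℝ) : ℝ :=
  ∫ t, (4 * Real.pi * t) ^ (-(d : ℝ) / 2) * Real.exp (-(r ^ 2) / (4 * t)) ∂S.m

/-- The condition `j(r) ≤ b₂ j(r+1)` for `r ≥ 1`. -/
def PsiSetting.kernelCond {d : ℕ} (S : PsiSetting d) : Prop :=
  ∀ r : ℝ, 1 ≤ r → S.j r ≤ S.b₂ * S.j (r + 1)

/-- The nonlocal operator `Ψ(−Δ)` applied to a test function. -/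
def psiOp {d : ℕ} (S : PsiSetting d) (φ : Rd d → ℝ) (x : Rd d) : ℝ :=
  ∫ z : Rd d,
    (φ x - φ (x + z) + (if ‖z‖ ≤ 1 then ⟪z, gradient φ x⟫ else 0)) * S.j ‖z‖

/-- Admissible test functions at `x`: bounded continuous and C² near `x`. -/
def TestAt {d : ℕ} (x : Rd d) (φ : Rd d → ℝ) : Prop :=
  (∃ M, ∀ y, |φ y| ≤ M) ∧ Continuous φ ∧ ∃ U ∈ nhds x, ContDiffOn ℝ 2 φ U

/-- Viscosity supersolution of `Ψ(−Δ)u + c·u = g` in `Ω`. -/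
def IsSuperSol {d : ℕ} (S : PsiSetting d) (Ω : Set (Rd d)) (c g u : Rd d → ℝ) : Prop :=
  LowerSemicontinuous u ∧
    ∀ x ∈ Ω, ∀ φ : Rd d → ℝ, TestAt x φ → φ x = u x → (∀ y, y ≠ x → φ y < u y) →
      g x ≤ psiOp S φ x + c x * u x

/-- Viscosity subsolution of `Ψ(−Δ)u + c·u = g` in `Ω`. -/
def IsSubSol {d : ℕ} (S : PsiSetting d) (Ω : Set (Rd d)) (c g u : Rd d → ℝ) : Prop :=
  UpperSemicontinuous u ∧
    ∀ x ∈ Ω, ∀ φ : Rd d → ℝ, TestAt x φ → φ x = u x → (∀ y, y ≠ x → u y < φ y) →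
      psiOp S φ x + c x * u x ≤ g x

/-- Viscosity solution of `Ψ(−Δ)u + c·u = g` in `Ω`. -/
def IsSol {d : ℕ} (S : PsiSetting d) (Ω : Set (Rd d)) (c g u : Rd d → ℝ) : Prop :=
  IsSubSol S Ω c g u ∧ IsSuperSol S Ω c g u

/-- `V` is the renewal function of the ascending ladder-height process associated with `Ψ`. -/
structure IsRenewal (Ψ V : ℝ → ℝ) : Prop where
  nonneg : ∀ x, 0 ≤ V x
  zero : ∀ x ≤ (0:ℝ), V x = 0
  cont : ContinuousOn V (Set.Ioi 0)
  mono : StrictMonoOn V (Set.Ioi 0)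
  laplace : ∀ s : ℝ, 0 < s →
    (∫ x in Set.Ioi (0 : ℝ), V x * Real.exp (-s * x)) =
      1 / (s * Real.exp ((1 / Real.pi) *
        ∫ y in Set.Ioi (0 : ℝ), Real.log (Ψ (s * y)) / (1 + y ^ 2)))

/-- `tr_V(u)(x) = t`: the `V`-trace of `u` at the boundary point `x` of `D`. -/
def HasVTrace {d : ℕ} (V : ℝ → ℝ) (D : Set (Rd d)) (u : Rd d → ℝ)
    (x : Rd d) (t : ℝ) : Prop :=
  Filter.Tendsto (fun z => u z / V (Metric.infDist z Dᶜ)) (nhdsWithin x D) (nhds t)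

/-- An open set has C² boundary. -/
def HasC2Boundary {d : ℕ} (D : Set (Rd d)) : Prop :=
  ∀ x ∈ frontier D, ∃ (U : Set (Rd d)) (f : Rd d → ℝ),
    IsOpen U ∧ x ∈ U ∧ ContDiffOn ℝ 2 f U ∧ (∀ y ∈ U, fderiv ℝ f y ≠ 0) ∧
      D ∩ U = {y ∈ U | f y < 0}

/-- A closed set has C² boundary. -/
def HasC2BoundaryClosed {d : ℕ} (G : Set (Rd d)) : Prop :=
  ∀ x ∈ frontier G, ∃ (U : Set (Rd d)) (f : Rd d → ℝ),
    IsOpen U ∧ x ∈ U ∧ ContDiffOn ℝ 2 f U ∧ (∀ y ∈ U, fderiv ℝ f y ≠ 0) ∧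
      G ∩ U = {y ∈ U | f y ≤ 0}

/-- Reflection `R_{λ,e}` across the hyperplane `{x·e = λ}`. -/
def reflAt {d : ℕ} (e : Rd d) (lam : ℝ) (x : Rd d) : Rd d :=
  x - (2 * ⟪x, e⟫ - 2 * lam) • e

/-- The open half-space `H_{λ,e} = {x·e > λ}`. -/
def halfSpace {d : ℕ} (e : Rd d) (lam : ℝ) : Set (Rd d) := {x | lam < ⟪x, e⟫}

/-- A function is antisymmetric with respect to the half-space `H_{λ,e}`. -/
def AntiSym {d : ℕ} (e : Rd d) (lam : ℝ) (u : Rd d → ℝ) : Prop :=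
  ∀ x, u x = - u (reflAt e lam x)

/-! ### The Lévy measure and the jump kernel -/

namespace PsiSetting

variable {d : ℕ} (S : PsiSetting d)

lemma ae_pos : ∀ᵐ t ∂S.m, 0 < t := by
  have h := S.m_onIoi
  rw [ae_iff]
  simpa [Set.Iic] using h

lemma Psi_one_ne_zero : S.Ψ 1 ≠ 0 := by
  intro h
  have h1 := S.scaling_lower 1 1 le_rfl le_rfl
  have h2 := S.hb₁
  rw [h] at h1
  norm_num at h1
  linarith

lemma integrable_one_sub_exp : Integrable (fun t => 1 - Real.exp (-t)) S.m := by
  by_contra h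
  apply S.Psi_one_ne_zero
  rw [S.levy_rep 1 one_pos]
  simpa using integral_undef h

lemma m_ne_zero : S.m ≠ 0 := by
  intro h
  apply S.Psi_one_ne_zero
  rw [S.levy_rep 1 one_pos, h, integral_zero_measure]

lemma sigmaFinite_m : SigmaFinite S.m := by
  set h : ℝ → ℝ≥0∞ := fun t => ENNReal.ofReal (1 - Real.exp (-t)) with hh
  have hm : Measurable h := by fun_prop
  have hne : ∀ᵐ t ∂S.m, h t ≠ 0 := by
    filter_upwards [S.ae_pos] with t ht
    simp only [hh, ne_eq, ENNReal.ofReal_eq_zero, not_le]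
    have := Real.exp_lt_one_iff.2 (neg_lt_zero.2 ht)
    linarith
  have htop : ∀ t, h t ≠ ⊤ := fun t => ENNReal.ofReal_ne_top
  have hfin : IsFiniteMeasure (S.m.withDensity h) :=
    isFiniteMeasure_withDensity (by
      simpa only [hh] using S.integrable_one_sub_exp.lintegral_lt_top.ne)
  rw [← withDensity_inv_same hm hne (Eventually.of_forall htop)]
  apply SigmaFinite.withDensity_of_ne_top
  filter_upwards [withDensity_absolutelyContinuous S.m h hne] with t ht
  simpa using ht

lemma integral_pos_of_pos {F : ℝ → ℝ} (hF : Integrable F S.m) (hpos : ∀ t, 0 < t → 0 < F t) :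
    0 < ∫ t, F t ∂S.m := by
  rw [integral_pos_iff_support_of_nonneg_ae
    (S.ae_pos.mono fun t ht => (hpos t ht).le) hF, pos_iff_ne_zero]
  intro h0
  apply S.m_ne_zero
  rw [← Measure.measure_univ_eq_zero]
  refine measure_mono_null (t := Function.support F ∪ Set.Iic 0) (fun t _ => ?_)
    (measure_union_null h0 S.m_onIoi)
  rcases le_or_gt t 0 with h | h
  · exact Or.inr h
  · exact Or.inl (Ne.symm (hpos t h).ne)

/-- The heat kernel subordinated by the Lévy measure. -/
def heat (d : ℕ) (s t : ℝ) : ℝ :=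
  (4 * Real.pi * t) ^ (-(d : ℝ) / 2) * Real.exp (-(s ^ 2) / (4 * t))

lemma j_eq (s : ℝ) : S.j s = ∫ t, heat d s t ∂S.m := rfl

lemma heat_pos (d : ℕ) (s : ℝ) {t : ℝ} (ht : 0 < t) : 0 < heat d s t := by
  unfold heat; positivity

lemma measurable_heat (d : ℕ) : Measurable (fun p : ℝ × ℝ => heat d p.1 p.2) := by
  unfold heat; fun_prop

lemma heat_lt {d : ℕ} {s s' t : ℝ} (hs : 0 ≤ s) (hss : s < s') (ht : 0 < t) :
    heat d s' t < heat d s t := by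
  unfold heat
  refine mul_lt_mul_of_pos_left (Real.exp_lt_exp.2 ?_) (by positivity)
  rw [div_lt_div_iff_of_pos_right (by positivity)]
  nlinarith

lemma min_mul_heat_le {s t : ℝ} (ht : 0 < t) :
    min 1 (s ^ 2) * heat d s t ≤
      16 * (1 - Real.exp (-t)) *
        ((4 * Real.pi * t) ^ (-(d : ℝ) / 2) * Real.exp (-(1 / (8 * t)) * s ^ 2)) := by
  unfold heat
  have hsplit : Real.exp (-(s ^ 2) / (4 * t)) =
      Real.exp (-(1 / (8 * t)) * s ^ 2) * Real.exp (-(1 / (8 * t)) * s ^ 2) := by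
    rw [← Real.exp_add]; congr 1; field_simp; ring
  set E := Real.exp (-(1 / (8 * t)) * s ^ 2) with hE
  have hE0 : 0 < E := Real.exp_pos _
  have hE1 : E ≤ 1 := Real.exp_le_one_iff.2 (by
    have : 0 ≤ 1 / (8 * t) * s ^ 2 := by positivity
    linarith)
  have hsE : s ^ 2 * E ≤ 8 * t := by
    have h1 : s ^ 2 / (8 * t) + 1 ≤ Real.exp (s ^ 2 / (8 * t)) := Real.add_one_le_exp _
    have h2 : E * Real.exp (s ^ 2 / (8 * t)) = 1 := by
      rw [hE, ← Real.exp_add, Real.exp_eq_one_iff]; field_simp; ring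
    have h3 : s ^ 2 / (8 * t) * E ≤ 1 := by nlinarith
    rw [div_mul_eq_mul_div, div_le_one (by positivity)] at h3
    exact h3
  have hmin : min 1 (s ^ 2) * E ≤ 16 * (1 - Real.exp (-t)) := by
    have h1 : t + 1 ≤ Real.exp t := Real.add_one_le_exp _
    have h2 : Real.exp (-t) * Real.exp t = 1 := by rw [← Real.exp_add]; simp
    have hp := Real.exp_pos (-t)
    have h3 : Real.exp (-t) * (1 + t) ≤ 1 := by nlinarith
    rcases le_total t 1 with h | h
    · have : min 1 (s ^ 2) * E ≤ 8 * t :=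
        (mul_le_mul_of_nonneg_right (min_le_right _ _) hE0.le).trans hsE
      nlinarith
    · have : min 1 (s ^ 2) * E ≤ 1 := by
        have h4 : min 1 (s ^ 2) ≤ 1 := min_le_left _ _
        nlinarith
      nlinarith
  rw [hsplit]
  have hP : 0 < (4 * Real.pi * t) ^ (-(d : ℝ) / 2) := by positivity
  calc _ = (min 1 (s ^ 2) * E) * ((4 * Real.pi * t) ^ (-(d : ℝ) / 2) * E) := by ring
    _ ≤ _ := mul_le_mul_of_nonneg_right hmin (by positivity)

lemma integral_wide_heat {t : ℝ} (ht : 0 < t) :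
    ∫ z : Rd d, (4 * Real.pi * t) ^ (-(d : ℝ) / 2) * Real.exp (-(1 / (8 * t)) * ‖z‖ ^ 2) =
      2 ^ ((d : ℝ) / 2) := by
  rw [integral_const_mul, GaussianFourier.integral_rexp_neg_mul_sq_norm (by positivity)]
  have : Real.pi / (1 / (8 * t)) = 2 * (4 * Real.pi * t) := by field_simp; ring
  have hb : 0 < 4 * Real.pi * t := by positivity
  rw [this, finrank_euclideanSpace_fin]
  generalize 4 * Real.pi * t = b at hb
  rw [Real.mul_rpow (by positivity) hb.le, mul_left_comm, ← Real.rpow_add hb, neg_div,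
    neg_add_cancel, Real.rpow_zero, mul_one]

lemma integrable_wide_heat {t : ℝ} (ht : 0 < t) :
    Integrable (fun z : Rd d =>
      (4 * Real.pi * t) ^ (-(d : ℝ) / 2) * Real.exp (-(1 / (8 * t)) * ‖z‖ ^ 2)) := by
  by_contra h
  have h1 := integral_wide_heat (d := d) ht
  rw [integral_undef h] at h1
  have : (0 : ℝ) < 2 ^ ((d : ℝ) / 2) := by positivity
  linarith

lemma integrable_prod_heat :
    Integrable (fun p : Rd d × ℝ => min 1 (‖p.1‖ ^ 2) * heat d ‖p.1‖ p.2)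
      ((volume : Measure (Rd d)).prod S.m) := by
  have := S.sigmaFinite_m
  have hmeas : Measurable (fun p : Rd d × ℝ => min 1 (‖p.1‖ ^ 2) * heat d ‖p.1‖ p.2) :=
    (by fun_prop : Measurable fun p : Rd d × ℝ => min 1 (‖p.1‖ ^ 2)).mul
      ((measurable_heat d).comp (by fun_prop : Measurable fun p : Rd d × ℝ => (‖p.1‖, p.2)))
  have hnn : ∀ (z : Rd d) {t : ℝ}, 0 < t → 0 ≤ min 1 (‖z‖ ^ 2) * heat d ‖z‖ t :=
    fun z t ht => mul_nonneg (by positivity) (heat_pos d _ ht).le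
  have hInt : ∀ {t : ℝ}, 0 < t →
      Integrable (fun z : Rd d => min 1 (‖z‖ ^ 2) * heat d ‖z‖ t) := by
    intro t ht
    refine ((integrable_wide_heat (d := d) ht).const_mul (16 * (1 - Real.exp (-t)))).mono'
      (hmeas.comp (by fun_prop : Measurable fun z : Rd d => (z, t))).aestronglyMeasurable
      (Eventually.of_forall fun z => ?_)
    rw [Real.norm_of_nonneg (hnn z ht)]
    exact min_mul_heat_le ht
  rw [integrable_prod_iff' hmeas.aestronglyMeasurable]
  refine ⟨S.ae_pos.mono fun t ht => hInt ht, ?_⟩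
  refine (S.integrable_one_sub_exp.const_mul (16 * 2 ^ ((d : ℝ) / 2))).mono'
    hmeas.stronglyMeasurable.norm.integral_prod_left'.aestronglyMeasurable ?_
  filter_upwards [S.ae_pos] with t ht
  rw [Real.norm_of_nonneg (integral_nonneg fun z => norm_nonneg _)]
  calc _ = ∫ z : Rd d, min 1 (‖z‖ ^ 2) * heat d ‖z‖ t :=
        integral_congr_ae (Eventually.of_forall fun z => Real.norm_of_nonneg (hnn z ht))
    _ ≤ ∫ z : Rd d, 16 * (1 - Real.exp (-t)) *
          ((4 * Real.pi * t) ^ (-(d : ℝ) / 2) * Real.exp (-(1 / (8 * t)) * ‖z‖ ^ 2)) :=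
        integral_mono (hInt ht) ((integrable_wide_heat ht).const_mul _)
          fun z => min_mul_heat_le ht
    _ = _ := by rw [integral_const_mul, integral_wide_heat ht]; ring

lemma integrable_min_mul_j :
    Integrable (fun z : Rd d => min 1 (‖z‖ ^ 2) * S.j ‖z‖) := by
  have := S.sigmaFinite_m
  have h := S.integrable_prod_heat.integral_prod_left
  simp only [integral_const_mul] at h
  exact h

lemma integrable_heat (hd : 0 < d) {s : ℝ} (hs : 0 < s) :
    Integrable (fun t => heat d s t) S.m := by
  have := S.sigmaFinite_m
  have : Nonempty (Fin d) := ⟨⟨0, hd⟩⟩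
  have hae : ∀ᵐ z : Rd d, z ≠ 0 := by
    simp [ae_iff]
  obtain ⟨z, ⟨hz, hz0⟩, hzs⟩ : ∃ z : Rd d,
      (Integrable (fun t => min 1 (‖z‖ ^ 2) * heat d ‖z‖ t) S.m ∧ z ≠ 0) ∧ z ∈ ball 0 s := by
    have h := S.integrable_prod_heat.prod_right_ae.and hae
    by_contra! hcon
    have : volume (ball (0 : Rd d) s) = 0 := measure_mono_null (fun z hz hP => hcon z hP hz) h
    exact (measure_ball_pos volume (0 : Rd d) hs).ne' this
  have hz1 : 0 < ‖z‖ := norm_pos_iff.2 hz0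
  have hc : min 1 (‖z‖ ^ 2) ≠ 0 := by positivity
  have hz2 : Integrable (fun t => heat d ‖z‖ t) S.m :=
    (integrable_const_mul_iff (isUnit_iff_ne_zero.2 hc) _).1 hz
  refine hz2.mono' ((measurable_heat d).comp
    (by fun_prop : Measurable fun t : ℝ => (s, t))).aestronglyMeasurable ?_
  filter_upwards [S.ae_pos] with t ht
  rw [Real.norm_of_nonneg (heat_pos d s ht).le]
  exact (heat_lt hz1.le (by simpa using hzs) ht).le

lemma j_nonneg (s : ℝ) : 0 ≤ S.j s :=
  integral_nonneg_of_ae (S.ae_pos.mono fun _ ht => (heat_pos d s ht).le)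

lemma j_lt (hd : 0 < d) {s s' : ℝ} (hs : 0 < s) (hss : s < s') : S.j s' < S.j s := by
  rw [← sub_pos, j_eq, j_eq,
    ← integral_sub (S.integrable_heat hd hs) (S.integrable_heat hd (hs.trans hss))]
  exact S.integral_pos_of_pos ((S.integrable_heat hd hs).sub (S.integrable_heat hd (hs.trans hss)))
    fun t ht => sub_pos.2 (heat_lt hs.le hss ht)

lemma measurable_j : Measurable S.j := by
  have := S.sigmaFinite_m
  exact (measurable_heat d).stronglyMeasurable.integral_prod_right.measurable

lemma measurable_j_norm : Measurable fun z : Rd d => S.j ‖z‖ :=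
  S.measurable_j.comp measurable_norm

lemma integral_min_mul_j_nonneg : 0 ≤ ∫ z : Rd d, min 1 (‖z‖ ^ 2) * S.j ‖z‖ :=
  integral_nonneg fun z => mul_nonneg (by positivity) (S.j_nonneg ‖z‖)

/-- Functions that are bounded and `O(‖z‖ ^ 2)` at the origin are integrable against the kernel. -/
lemma integrable_mul_j {F : Rd d → ℝ} (hF : AEStronglyMeasurable F volume) (C : ℝ)
    (hC : ∀ z, |F z| ≤ C * min 1 (‖z‖ ^ 2)) : Integrable (fun z => F z * S.j ‖z‖) := by
  refine (S.integrable_min_mul_j.const_mul C).mono'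
    (hF.mul S.measurable_j_norm.aestronglyMeasurable) (Eventually.of_forall fun z => ?_)
  rw [norm_mul, Real.norm_of_nonneg (S.j_nonneg _), ← mul_assoc]
  exact mul_le_mul_of_nonneg_right (hC z) (S.j_nonneg _)

end PsiSetting

/-! ### Viscosity inequalities with paraboloids -/

/-- The one-point viscosity subsolution inequality `Ψ(−Δ)u(x) ≤ c`. -/
def SubAt {d : ℕ} (S : PsiSetting d) (u : Rd d → ℝ) (x : Rd d) (c : ℝ) : Prop :=
  ∀ φ : Rd d → ℝ, TestAt x φ → φ x = u x → (∀ y, y ≠ x → u y < φ y) → psiOp S φ x ≤ c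

/-- The compensated increment of `u` at `x`, where `u` is replaced on `B_δ(x)` by the paraboloid
of slope `p` and opening `K`. -/
def cutIncr {d : ℕ} (u : Rd d → ℝ) (x p : Rd d) (K δ : ℝ) (z : Rd d) : ℝ :=
  if ‖z‖ < δ then -(K * ‖z‖ ^ 2) else u x - u (x + z) + if ‖z‖ ≤ 1 then ⟪p, z⟫ else 0

/-- The subsolution inequality evaluated on `u` itself away from `x`, whenever `u` is touched from
above at `x` by a paraboloid. -/
def ParabSubAt {d : ℕ} (S : PsiSetting d) (u : Rd d → ℝ) (x : Rd d) (c : ℝ) : Prop :=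
  ∀ (p : Rd d) (K ρ δ : ℝ), 0 ≤ K → 0 < δ → δ ≤ 1 → δ < ρ →
    (∀ z, ‖z‖ < ρ → u (x + z) ≤ u x + ⟪p, z⟫ + K * ‖z‖ ^ 2) →
    ∫ z, cutIncr u x p K δ z * S.j ‖z‖ ≤ c

lemma le_of_forall_pos_le_add_mul {X c I : ℝ} (hI : 0 ≤ I) (h : ∀ κ > 0, X ≤ c + κ * I) :
    X ≤ c := by
  refine le_of_forall_pos_le_add fun ε hε => ?_
  have h1 := h (ε / (I + 1)) (by positivity)
  have h2 : ε / (I + 1) * I ≤ ε := by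
    rw [div_mul_eq_mul_div, div_le_iff₀ (by positivity)]
    nlinarith
  linarith

section Parab

variable {d : ℕ}

lemma sq_le_min_one_sq {δ s : ℝ} (hδ : 0 ≤ δ) (hδ1 : δ ≤ 1) (hs : δ ≤ s) :
    δ ^ 2 ≤ min 1 (s ^ 2) :=
  le_min (pow_le_one₀ hδ hδ1) (pow_le_pow_left₀ hδ hs 2)

lemma abs_le_const_mul_min {a C δ s : ℝ} (hδ : 0 < δ) (hδ1 : δ ≤ 1) (hs : δ ≤ s) (ha : |a| ≤ C) :
    |a| ≤ C / δ ^ 2 * min 1 (s ^ 2) := by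
  have hC : 0 ≤ C := (abs_nonneg a).trans ha
  calc |a| ≤ C := ha
    _ = C / δ ^ 2 * δ ^ 2 := by field_simp
    _ ≤ _ := mul_le_mul_of_nonneg_left (sq_le_min_one_sq hδ.le hδ1 hs) (by positivity)

lemma abs_inner_ite_le (p z : Rd d) : |if ‖z‖ ≤ 1 then ⟪p, z⟫ else 0| ≤ ‖p‖ := by
  split_ifs with h
  · calc |⟪p, z⟫| ≤ ‖p‖ * ‖z‖ := abs_real_inner_le_norm p z
      _ ≤ ‖p‖ * 1 := mul_le_mul_of_nonneg_left h (norm_nonneg p)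
      _ = ‖p‖ := mul_one _
  · simp

lemma abs_cutIncr_le {u : Rd d → ℝ} {M : ℝ} (hM : ∀ y, |u y| ≤ M) (x p : Rd d) {K δ : ℝ}
    (hK : 0 ≤ K) (hδ : 0 < δ) (hδ1 : δ ≤ 1) (z : Rd d) :
    |cutIncr u x p K δ z| ≤ (K + (2 * M + ‖p‖) / δ ^ 2) * min 1 (‖z‖ ^ 2) := by
  have hM0 : 0 ≤ M := (abs_nonneg _).trans (hM x)
  have hmin : 0 ≤ min 1 (‖z‖ ^ 2) := by positivity
  unfold cutIncr
  rw [add_mul]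
  by_cases h1 : ‖z‖ < δ
  · rw [if_pos h1]
    have h2 : ‖z‖ ^ 2 ≤ 1 := pow_le_one₀ (norm_nonneg z) (h1.le.trans hδ1)
    rw [abs_neg, abs_of_nonneg (by positivity), min_eq_right h2]
    have : 0 ≤ (2 * M + ‖p‖) / δ ^ 2 * ‖z‖ ^ 2 := by positivity
    linarith
  · rw [if_neg h1]
    refine (abs_le_const_mul_min hδ hδ1 (not_lt.1 h1) ?_).trans
      (le_add_of_nonneg_left (by positivity))
    refine (abs_add_le _ _).trans (add_le_add ((abs_sub _ _).trans ?_) (abs_inner_ite_le p z))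
    linarith [hM x, hM (x + z)]

lemma measurable_cutIncr {u : Rd d → ℝ} (hu : Continuous u) (x p : Rd d) (K δ : ℝ) :
    Measurable (cutIncr u x p K δ) := by
  unfold cutIncr
  have := hu.measurable
  refine Measurable.ite (measurableSet_lt (by fun_prop) (by fun_prop)) (by fun_prop) ?_
  refine Measurable.add (by fun_prop) ?_
  exact Measurable.ite (measurableSet_le (by fun_prop) (by fun_prop)) (by fun_prop) (by fun_prop)

lemma integrable_cutIncr (S : PsiSetting d) {u : Rd d → ℝ} (hu : Continuous u) {M : ℝ}
    (hM : ∀ y, |u y| ≤ M) (x p : Rd d) {K δ : ℝ} (hK : 0 ≤ K) (hδ : 0 < δ) (hδ1 : δ ≤ 1) :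
    Integrable fun z => cutIncr u x p K δ z * S.j ‖z‖ :=
  S.integrable_mul_j (measurable_cutIncr hu x p K δ).aestronglyMeasurable _
    (abs_cutIncr_le hM x p hK hδ hδ1)

lemma hasGradientAt_paraboloid (a : ℝ) (x p : Rd d) (K : ℝ) :
    HasGradientAt (fun y => a + ⟪p, y - x⟫ + K * ‖y - x‖ ^ 2) p x := by
  rw [hasGradientAt_iff_hasFDerivAt]
  have h0 : HasFDerivAt (fun y : Rd d => y - x) (ContinuousLinearMap.id ℝ (Rd d)) x :=
    (hasFDerivAt_id x).sub_const x
  have h1 : HasFDerivAt (fun y => a + ⟪p, y - x⟫) (innerSL ℝ p) x :=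
    ((innerSL ℝ p).hasFDerivAt.comp x h0).const_add a
  have h2 := (h0.norm_sq).const_mul K
  convert! h1.add h2 using 1
  ext y
  simp

/-- A cutoff equal to `1` on `B_{δ/2}` and to `0` off `B_δ`. -/
def tent (δ s : ℝ) : ℝ := max 0 (min 1 (2 - 2 * s / δ))

lemma tent_eq_one {δ s : ℝ} (hδ : 0 < δ) (hs : s ≤ δ / 2) : tent δ s = 1 := by
  have : 2 * s / δ ≤ 1 := by rw [div_le_one hδ]; linarith
  unfold tent
  rw [min_eq_left (by linarith)]
  simp

lemma tent_eq_zero {δ s : ℝ} (hδ : 0 < δ) (hs : δ ≤ s) : tent δ s = 0 := by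
  have : 2 ≤ 2 * s / δ := by rw [le_div_iff₀ hδ]; linarith
  unfold tent
  exact max_eq_left ((min_le_right _ _).trans (by linarith))

lemma tent_nonneg (δ s : ℝ) : 0 ≤ tent δ s := le_max_left _ _

lemma tent_le_one (δ s : ℝ) : tent δ s ≤ 1 := max_le zero_le_one (min_le_left _ _)

lemma SubAt.parabSubAt {S : PsiSetting d} {u : Rd d → ℝ} {x : Rd d} {c : ℝ}
    (h : SubAt S u x c) (hu : Continuous u) {M : ℝ} (hM : ∀ y, |u y| ≤ M) :
    ParabSubAt S u x c := by
  intro p K ρ δ hK hδ hδ1 hδρ htouch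
  have hM0 : 0 ≤ M := (abs_nonneg _).trans (hM x)
  refine le_of_forall_pos_le_add_mul S.integral_min_mul_j_nonneg fun κ hκ => ?_
  rw [← sub_le_iff_le_add]
  set P : Rd d → ℝ := fun z => u x + ⟪p, z⟫ + K * ‖z‖ ^ 2 with hP
  set ψ : Rd d → ℝ := fun z =>
    tent δ ‖z‖ * P z + (1 - tent δ ‖z‖) * u (x + z) + κ * min 1 (‖z‖ ^ 2) with hψ
  have hψnear : ∀ z, ‖z‖ ≤ δ / 2 → ψ z = u x + ⟪p, z⟫ + (K + κ) * ‖z‖ ^ 2 := by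
    intro z hz
    have h1 : ‖z‖ ^ 2 ≤ 1 := pow_le_one₀ (norm_nonneg z) (by linarith)
    simp only [hψ, hP, tent_eq_one hδ hz, min_eq_right h1]
    ring
  have hψbound : ∀ z, |ψ z| ≤ 2 * M + ‖p‖ + K + κ := by
    intro z
    have h1 : |tent δ ‖z‖ * P z| ≤ M + ‖p‖ + K := by
      rcases lt_or_ge ‖z‖ δ with hz | hz
      · have hz1 : ‖z‖ ≤ 1 := hz.le.trans hδ1
        have h2 : |P z| ≤ M + ‖p‖ + K := by
          refine (abs_add_le _ _).trans (add_le_add ((abs_add_le _ _).trans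
            (add_le_add (hM x) ?_)) ?_)
          · simpa [hz1] using abs_inner_ite_le p z
          · rw [abs_of_nonneg (by positivity)]
            exact mul_le_of_le_one_right hK (pow_le_one₀ (norm_nonneg z) hz1)
        rw [abs_mul, abs_of_nonneg (tent_nonneg _ _)]
        exact (mul_le_of_le_one_left (abs_nonneg _) (tent_le_one _ _)).trans h2
      · rw [tent_eq_zero hδ hz, zero_mul, abs_zero]; positivity
    have h3 : |(1 - tent δ ‖z‖) * u (x + z)| ≤ M := by
      rw [abs_mul, abs_of_nonneg (sub_nonneg.2 (tent_le_one _ _))]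
      exact (mul_le_of_le_one_left (abs_nonneg _) (by linarith [tent_nonneg δ ‖z‖])).trans (hM _)
    have h4 : |κ * min 1 (‖z‖ ^ 2)| ≤ κ := by
      rw [abs_of_nonneg (by positivity)]
      exact mul_le_of_le_one_right hκ.le (min_le_left _ _)
    have h5 := abs_add_le (tent δ ‖z‖ * P z + (1 - tent δ ‖z‖) * u (x + z))
      (κ * min 1 (‖z‖ ^ 2))
    have h6 := abs_add_le (tent δ ‖z‖ * P z) ((1 - tent δ ‖z‖) * u (x + z))
    simp only [hψ]
    linarith
  have hψcont : Continuous ψ := by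
    have : Continuous fun z : Rd d => tent δ ‖z‖ := by unfold tent; fun_prop
    simp only [hψ, hP]
    fun_prop
  have hψ0 : ψ 0 = u x := by
    rw [hψnear 0 (by simp; positivity)]; simp
  have hψlt : ∀ z, z ≠ 0 → u (x + z) < ψ z := by
    intro z hz
    have hz0 : 0 < ‖z‖ := norm_pos_iff.2 hz
    have h1 : 0 < κ * min 1 (‖z‖ ^ 2) := by positivity
    have h2 : 0 ≤ tent δ ‖z‖ * (P z - u (x + z)) := by
      rcases lt_or_ge ‖z‖ δ with h | h
      · exact mul_nonneg (tent_nonneg _ _) (sub_nonneg.2 (htouch z (h.trans hδρ)))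
      · rw [tent_eq_zero hδ h, zero_mul]
    simp only [hψ]
    linarith
  set φ : Rd d → ℝ := fun y => ψ (y - x) with hφ
  have hφnear : φ =ᶠ[𝓝 x] fun y => u x + ⟪p, y - x⟫ + (K + κ) * ‖y - x‖ ^ 2 := by
    filter_upwards [closedBall_mem_nhds x (half_pos hδ)] with y hy
    exact hψnear _ (by rwa [← dist_eq_norm])
  have hgrad : gradient φ x = p :=
    ((hasGradientAt_paraboloid (u x) x p (K + κ)).congr_of_eventuallyEq hφnear).gradient
  have htest : TestAt x φ := by
    refine ⟨⟨_, fun y => hψbound _⟩, hψcont.comp (by fun_prop), _,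
      closedBall_mem_nhds x (half_pos hδ), ?_⟩
    refine ContDiffOn.congr (f := fun y => u x + ⟪p, y - x⟫ + (K + κ) * ‖y - x‖ ^ 2) ?_
      fun y hy => hψnear _ (by rwa [← dist_eq_norm])
    apply ContDiff.contDiffOn
    have : ContDiff ℝ 2 fun y : Rd d => ‖y - x‖ ^ 2 := (contDiff_id.sub contDiff_const).norm_sq ℝ
    have h2 : ContDiff ℝ 2 fun y : Rd d => ⟪p, y - x⟫ :=
      contDiff_const.inner ℝ (contDiff_id.sub contDiff_const)
    fun_prop
  have hop := h φ htest (by simp [hφ, hψ0]) fun y hy => by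
    simpa [hφ] using hψlt (y - x) (sub_ne_zero.2 hy)
  refine le_trans ?_ hop
  set F : Rd d → ℝ := fun z => u x - ψ z + if ‖z‖ ≤ 1 then ⟪p, z⟫ else 0 with hF
  have hopeq : psiOp S φ x = ∫ z, F z * S.j ‖z‖ := by
    simp only [psiOp, hφ, sub_self, add_sub_cancel_left, hψ0, hF]
    simp only [hφ] at hgrad
    simp only [hgrad, real_inner_comm]
  have hFmeas : Measurable F := by
    have := hψcont.measurable
    exact Measurable.add (by fun_prop)
      (Measurable.ite (measurableSet_le (by fun_prop) (by fun_prop)) (by fun_prop) (by fun_prop))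
  have hFint : Integrable fun z => F z * S.j ‖z‖ := by
    refine S.integrable_mul_j hFmeas.aestronglyMeasurable
      ((K + κ) + (M + (2 * M + ‖p‖ + K + κ) + ‖p‖) / (δ / 2) ^ 2) fun z => ?_
    have hmin : 0 ≤ min 1 (‖z‖ ^ 2) := by positivity
    rw [add_mul]
    rcases le_or_gt ‖z‖ (δ / 2) with hz | hz
    · have hz1 : ‖z‖ ≤ 1 := by linarith
      have h1 : F z = -((K + κ) * ‖z‖ ^ 2) := by
        simp only [hF, hψnear z hz, if_pos hz1]; ring
      rw [h1, abs_neg, abs_of_nonneg (by positivity),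
        min_eq_right (pow_le_one₀ (norm_nonneg z) hz1)]
      exact le_add_of_nonneg_right (by positivity)
    · refine (abs_le_const_mul_min (half_pos hδ) (by linarith) hz.le ?_).trans
        (le_add_of_nonneg_left (by positivity))
      exact (abs_add_le _ _).trans (add_le_add ((abs_sub _ _).trans
        (add_le_add (hM x) (hψbound z))) (abs_inner_ite_le p z))
  have hcut := integrable_cutIncr S hu hM x p hK hδ hδ1
  rw [hopeq, ← integral_const_mul, ← integral_sub hcut (S.integrable_min_mul_j.const_mul κ)]
  refine integral_mono (hcut.sub (S.integrable_min_mul_j.const_mul κ)) hFint fun z => ?_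
  have hle : cutIncr u x p K δ z - κ * min 1 (‖z‖ ^ 2) ≤ F z := by
    unfold cutIncr
    simp only [hF, hψ]
    split_ifs with h1 h2 h2
    · have h3 := mul_nonneg (sub_nonneg.2 (tent_le_one δ ‖z‖))
        (sub_nonneg.2 (htouch z (h1.trans hδρ)))
      simp only [hP]
      linarith
    · exact absurd (h1.le.trans hδ1) h2
    · rw [tent_eq_zero hδ (not_lt.1 h1)]; linarith
    · rw [tent_eq_zero hδ (not_lt.1 h1)]; linarith
  calc _ = (cutIncr u x p K δ z - κ * min 1 (‖z‖ ^ 2)) * S.j ‖z‖ := by ring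
    _ ≤ _ := mul_le_mul_of_nonneg_right hle (S.j_nonneg _)

lemma psiOp_neg (S : PsiSetting d) (φ : Rd d → ℝ) (x : Rd d) :
    psiOp S (fun y => -φ y) x = -psiOp S φ x := by
  have hg : gradient (fun y => -φ y) x = -gradient φ x := by
    simp [gradient, fderiv_fun_neg]
  unfold psiOp
  rw [← integral_neg, hg]
  congr 1
  ext z
  split_ifs
  · rw [inner_neg_right]; ring
  · ring

lemma ParabSubAt.comp_isometry {S : PsiSetting d} {u : Rd d → ℝ} {x : Rd d} {c : ℝ}
    (L : Rd d ≃ₗᵢ[ℝ] Rd d) (b : Rd d) (h : ParabSubAt S u (L x + b) c) :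
    ParabSubAt S (fun y => u (L y + b)) x c := by
  intro p K ρ δ hK hδ hδ1 hδρ htouch
  have h1 := h (L p) K ρ δ hK hδ hδ1 hδρ fun z hz => by
    have h2 := htouch (L.symm z) (by simpa using hz)
    rw [← L.inner_map_map] at h2
    simpa [add_right_comm] using h2
  rw [← (L.measurePreserving).integral_comp L.toMeasurableEquiv.measurableEmbedding] at h1
  refine (integral_congr_ae (Eventually.of_forall fun z => ?_)).trans_le h1
  simp only [cutIncr, L.norm_map, L.inner_map_map, map_add, add_right_comm]

end Parab

/-! ### Doubling of variables -/

section Doubling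

variable {d : ℕ}

lemma PsiSetting.integrableOn_mul_j (S : PsiSetting d) {F : Rd d → ℝ} (hF : Measurable F)
    {C σ : ℝ} (hC : ∀ z, |F z| ≤ C) (hσ : 0 < σ) (hσ1 : σ ≤ 1) :
    IntegrableOn (fun z => F z * S.j ‖z‖) (ball 0 σ)ᶜ := by
  have hm : MeasurableSet (ball (0 : Rd d) σ)ᶜ := measurableSet_ball.compl
  have hC0 : 0 ≤ C := (abs_nonneg _).trans (hC 0)
  rw [← integrable_indicator_iff hm]
  have h := S.integrable_mul_j (F := (ball (0 : Rd d) σ)ᶜ.indicator F)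
    (hF.indicator hm).aestronglyMeasurable (C / σ ^ 2) fun z => by
      by_cases hz : z ∈ (ball (0 : Rd d) σ)ᶜ
      · rw [indicator_of_mem hz]
        exact abs_le_const_mul_min hσ hσ1 (by simpa using hz) (hC z)
      · rw [indicator_of_notMem hz, abs_zero]
        positivity
  refine h.congr (Eventually.of_forall fun z => ?_)
  simp only [indicator]
  split_ifs <;> simp

lemma PsiSetting.tendsto_setIntegral_ball (S : PsiSetting d) (hd : 0 < d) :
    Tendsto (fun δ : ℝ => ∫ z in ball (0 : Rd d) δ, min 1 (‖z‖ ^ 2) * S.j ‖z‖)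
      (𝓝[>] 0) (𝓝 0) := by
  refine S.integrable_min_mul_j.tendsto_setIntegral_nhds_zero ?_
  have h1 : Tendsto (fun δ : ℝ => ENNReal.ofReal (δ ^ d) * volume (ball (0 : Rd d) 1))
      (𝓝[>] 0) (𝓝 0) := by
    have h2 : Tendsto (fun δ : ℝ => ENNReal.ofReal (δ ^ d)) (𝓝[>] 0) (𝓝 0) := by
      have h3 : Continuous fun δ : ℝ => ENNReal.ofReal (δ ^ d) :=
        ENNReal.continuous_ofReal.comp (continuous_pow d)
      have h4 := (h3.tendsto 0).mono_left (nhdsWithin_le_nhds (s := Ioi 0))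
      simpa [hd.ne'] using h4
    simpa using ENNReal.Tendsto.mul_const h2 (Or.inr measure_ball_lt_top.ne)
  refine h1.congr' ?_
  filter_upwards [self_mem_nhdsWithin] with δ hδ
  have := Measure.addHaar_ball_of_pos (volume : Measure (Rd d)) 0 hδ
  simpa using this.symm

/-- The penalised doubled functional. -/
def doubled (u v : Rd d → ℝ) (x₀ : Rd d) (N η : ℝ) (q : Rd d × Rd d) : ℝ :=
  u q.1 - v q.2 - N * ‖q.1 - q.2‖ ^ 2 - η * ‖q.1 - x₀‖ ^ 2

/-- The compensated increment of `u - v` at a maximum point of `doubled`. -/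
def doubledIncr (u v : Rd d → ℝ) (x₀ : Rd d) (η : ℝ) (x y z : Rd d) : ℝ :=
  u x - v y - (u (x + z) - v (y + z)) + if ‖z‖ ≤ 1 then ⟪(2 * η) • (x - x₀), z⟫ else 0

lemma measurable_doubledIncr {u v : Rd d → ℝ} (hu : Continuous u) (hv : Continuous v)
    (x₀ : Rd d) (η : ℝ) (x y : Rd d) : Measurable (doubledIncr u v x₀ η x y) := by
  have := hu.measurable
  have := hv.measurable
  exact Measurable.add (by fun_prop)
    (Measurable.ite (measurableSet_le (by fun_prop) (by fun_prop)) (by fun_prop) (by fun_prop))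

lemma abs_doubledIncr_le {u v : Rd d → ℝ} {M : ℝ} (hMu : ∀ y, |u y| ≤ M) (hMv : ∀ y, |v y| ≤ M)
    (x₀ : Rd d) {η : ℝ} (hη : 0 ≤ η) (x y z : Rd d) :
    |doubledIncr u v x₀ η x y z| ≤ 4 * M + 2 * η * ‖x - x₀‖ := by
  refine (abs_add_le _ _).trans (add_le_add ?_ ((abs_inner_ite_le _ z).trans_eq ?_))
  · refine (abs_sub _ _).trans ?_
    linarith [abs_sub (u x) (v y), abs_sub (u (x + z)) (v (y + z)), hMu x, hMu (x + z), hMv y,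
      hMv (y + z)]
  · rw [norm_smul, Real.norm_of_nonneg (by positivity)]

lemma integral_doubledIncr_le (hd : 0 < d) {S : PsiSetting d} {u v : Rd d → ℝ}
    (hu : Continuous u) (hv : Continuous v) {M : ℝ} (hMu : ∀ y, |u y| ≤ M)
    (hMv : ∀ y, |v y| ≤ M) {x₀ x y : Rd d} {ρ σ N η a b : ℝ} (hN : 0 ≤ N) (hη : 0 ≤ η)
    (hσ : 0 < σ) (hσ1 : σ ≤ 1) (hσρ : σ < ρ)
    (hmax : ∀ z w, ‖z‖ < ρ → ‖w‖ < ρ →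
      doubled u v x₀ N η (x + z, y + w) ≤ doubled u v x₀ N η (x, y))
    (ha : ParabSubAt S u x a) (hb : ParabSubAt S (fun y => -v y) y b) :
    ∫ z in (ball 0 σ)ᶜ, doubledIncr u v x₀ η x y z * S.j ‖z‖ ≤
      a + b + η * ∫ z : Rd d, min 1 (‖z‖ ^ 2) * S.j ‖z‖ := by
  set I := ∫ z : Rd d, min 1 (‖z‖ ^ 2) * S.j ‖z‖ with hI
  set p : Rd d := (2 * N) • (x - y) + (2 * η) • (x - x₀) with hp
  set q : Rd d := -((2 * N) • (x - y)) with hq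
  have hexp1 : ∀ z, ‖x + z - y‖ ^ 2 = ‖x - y‖ ^ 2 + 2 * ⟪x - y, z⟫ + ‖z‖ ^ 2 := fun z => by
    rw [← norm_add_sq_real]; congr 2; abel
  have hexp2 : ∀ z, ‖x + z - x₀‖ ^ 2 = ‖x - x₀‖ ^ 2 + 2 * ⟪x - x₀, z⟫ + ‖z‖ ^ 2 := fun z => by
    rw [← norm_add_sq_real]; congr 2; abel
  have hexp3 : ∀ z, ‖x - (y + z)‖ ^ 2 = ‖x - y‖ ^ 2 - 2 * ⟪x - y, z⟫ + ‖z‖ ^ 2 := fun z => by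
    rw [← norm_sub_sq_real]; congr 2; abel
  have htu : ∀ z, ‖z‖ < ρ → u (x + z) ≤ u x + ⟪p, z⟫ + (N + η) * ‖z‖ ^ 2 := by
    intro z hz
    have h := hmax z 0 hz (by simpa using hσ.trans hσρ)
    simp only [doubled, add_zero, hexp1, hexp2] at h
    simp only [hp, inner_add_left, real_inner_smul_left]
    linarith
  have htv : ∀ z, ‖z‖ < ρ → -v (y + z) ≤ -v y + ⟪q, z⟫ + N * ‖z‖ ^ 2 := by
    intro z hz
    have h := hmax 0 z (by simpa using hσ.trans hσρ) hz
    simp only [doubled, add_zero, hexp3] at h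
    simp only [hq, inner_neg_left, real_inner_smul_left]
    linarith
  have hdiag : ∀ z, ‖z‖ < ρ → -(η * ‖z‖ ^ 2) ≤
      u x - v y - (u (x + z) - v (y + z)) + 2 * η * ⟪x - x₀, z⟫ := by
    intro z hz
    have h := hmax z z hz hz
    simp only [doubled, add_sub_add_right_eq_sub, hexp2] at h
    linarith
  have hminint := S.integrable_min_mul_j
  have hBint : IntegrableOn (fun z => doubledIncr u v x₀ η x y z * S.j ‖z‖) (ball 0 σ)ᶜ :=
    S.integrableOn_mul_j (measurable_doubledIncr hu hv x₀ η x y)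
      (abs_doubledIncr_le hMu hMv x₀ hη x y) hσ hσ1
  have hmc : MeasurableSet (ball (0 : Rd d) σ)ᶜ := measurableSet_ball.compl
  have hδle : ∀ δ ∈ Ioo 0 σ, ∫ z in (ball 0 σ)ᶜ, doubledIncr u v x₀ η x y z * S.j ‖z‖ ≤
      a + b + η * I + (2 * N + η) * ∫ z in ball (0 : Rd d) δ, min 1 (‖z‖ ^ 2) * S.j ‖z‖ := by
    rintro δ ⟨hδ, hδσ⟩
    have hδ1 := hδσ.le.trans hσ1
    have h1 := ha p (N + η) ρ δ (by positivity) hδ hδ1 (hδσ.trans hσρ) htu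
    have h2 := hb q N ρ δ hN hδ hδ1 (hδσ.trans hσρ) htv
    have hi1 := integrable_cutIncr S hu hMu x p (add_nonneg hN hη) hδ hδ1
    have hi2 := integrable_cutIncr S (u := fun y => -v y) hv.neg
      (fun y => (abs_neg (v y)).trans_le (hMv y)) y q hN hδ hδ1
    have hi3 : Integrable fun z => (ball (0 : Rd d) σ)ᶜ.indicator
        (fun z => doubledIncr u v x₀ η x y z * S.j ‖z‖) z := hBint.integrable_indicator hmc
    have hi4 : Integrable fun z : Rd d => η * (min 1 (‖z‖ ^ 2) * S.j ‖z‖) := hminint.const_mul η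
    have hi5 : Integrable fun z : Rd d => (2 * N + η) * (ball (0 : Rd d) δ).indicator
        (fun z => min 1 (‖z‖ ^ 2) * S.j ‖z‖) z :=
      (hminint.indicator measurableSet_ball).const_mul _
    have hi34 : Integrable fun z => (ball (0 : Rd d) σ)ᶜ.indicator
        (fun z => doubledIncr u v x₀ η x y z * S.j ‖z‖) z -
        η * (min 1 (‖z‖ ^ 2) * S.j ‖z‖) := hi3.sub hi4
    have h3 : ∫ z, ((ball (0 : Rd d) σ)ᶜ.indicator
          (fun z => doubledIncr u v x₀ η x y z * S.j ‖z‖) z -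
          η * (min 1 (‖z‖ ^ 2) * S.j ‖z‖) -
          (2 * N + η) * (ball (0 : Rd d) δ).indicator
            (fun z => min 1 (‖z‖ ^ 2) * S.j ‖z‖) z) ≤
        ∫ z, (cutIncr u x p (N + η) δ z * S.j ‖z‖ +
          cutIncr (fun y => -v y) y q N δ z * S.j ‖z‖) := by
      refine integral_mono (hi34.sub hi5) (hi1.add hi2) fun z => ?_
      have hj := S.j_nonneg ‖z‖
      have hm0 : 0 ≤ min 1 (‖z‖ ^ 2) * S.j ‖z‖ := mul_nonneg (by positivity) hj
      dsimp only
      rcases lt_or_ge ‖z‖ δ with hz | hz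
      · rw [indicator_of_notMem (by simpa using hz.trans hδσ), indicator_of_mem (by simpa using hz)]
        simp only [cutIncr, if_pos hz]
        rw [min_eq_right (pow_le_one₀ (norm_nonneg z) (hz.le.trans hδ1))] at hm0 ⊢
        nlinarith [mul_nonneg hη hm0]
      · rw [indicator_of_notMem (s := ball (0 : Rd d) δ) (by simpa using hz)]
        simp only [cutIncr, if_neg (not_lt.2 hz)]
        have hsum : (u x - u (x + z) + if ‖z‖ ≤ 1 then ⟪p, z⟫ else 0) +
            (-v y - -v (y + z) + if ‖z‖ ≤ 1 then ⟪q, z⟫ else 0) =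
            doubledIncr u v x₀ η x y z := by
          simp only [doubledIncr, hp, hq, inner_add_left, inner_neg_left]
          split_ifs <;> ring
        rw [← add_mul, hsum]
        rcases lt_or_ge ‖z‖ σ with hz' | hz'
        · rw [indicator_of_notMem (by simpa using hz')]
          have hz1 : ‖z‖ ≤ 1 := hz'.le.trans hσ1
          have h4 := hdiag z (hz'.trans hσρ)
          simp only [doubledIncr, if_pos hz1, real_inner_smul_left,
            min_eq_right (pow_le_one₀ (norm_nonneg z) hz1)]
          nlinarith [mul_le_mul_of_nonneg_right h4 hj]
        · rw [indicator_of_mem (by simpa using hz')]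
          nlinarith [mul_nonneg hη hm0]
    rw [integral_add hi1 hi2, integral_sub hi34 hi5, integral_sub hi3 hi4, integral_const_mul,
      integral_const_mul, integral_indicator hmc, integral_indicator measurableSet_ball] at h3
    linarith
  have hlim := ((S.tendsto_setIntegral_ball hd).const_mul (2 * N + η)).const_add (a + b + η * I)
  rw [mul_zero, add_zero] at hlim
  exact ge_of_tendsto hlim (eventually_of_mem (Ioo_mem_nhdsGT hσ) hδle)

/-- Near a local maximum of `u - v`, the difference of a subsolution `u` and a supersolution `v`
satisfies the corresponding nonlocal inequality. -/
lemma setIntegral_sub_le_of_isLocalMax (hd : 0 < d) {S : PsiSetting d} {u v : Rd d → ℝ}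
    (hu : UniformContinuous u) (hv : UniformContinuous v) {M : ℝ} (hMu : ∀ y, |u y| ≤ M)
    (hMv : ∀ y, |v y| ≤ M) {x₀ : Rd d} {ρ σ : ℝ} (hσ : 0 < σ) (hσ1 : σ ≤ 1) (hσρ : 2 * σ < ρ)
    (hmax : ∀ x ∈ closedBall x₀ ρ, u x - v x ≤ u x₀ - v x₀) {a b : Rd d → ℝ}
    (hac : ContinuousAt a x₀) (hbc : ContinuousAt b x₀)
    (ha : ∀ x ∈ closedBall x₀ ρ, ParabSubAt S u x (a x))
    (hb : ∀ y ∈ closedBall x₀ ρ, ParabSubAt S (fun y => -v y) y (b y)) :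
    ∫ z in (ball 0 σ)ᶜ, (u x₀ - v x₀ - (u (x₀ + z) - v (x₀ + z))) * S.j ‖z‖ ≤ a x₀ + b x₀ := by
  have hρ : 0 < ρ := by linarith
  have hM0 : 0 ≤ M := (abs_nonneg _).trans (hMu x₀)
  refine le_of_forall_pos_le_add_mul S.integral_min_mul_j_nonneg fun η hη => ?_
  have hex : ∀ n : ℕ, ∃ q ∈ closedBall x₀ ρ ×ˢ closedBall x₀ ρ,
      IsMaxOn (doubled u v x₀ n η) (closedBall x₀ ρ ×ˢ closedBall x₀ ρ) q := fun n => by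
    refine ((isCompact_closedBall x₀ ρ).prod (isCompact_closedBall x₀ ρ)).exists_isMaxOn
      ⟨(x₀, x₀), by simp [hρ.le]⟩ (Continuous.continuousOn ?_)
    have := hu.continuous
    have := hv.continuous
    unfold doubled
    fun_prop
  choose q hq hqmax using hex
  have hbase : ∀ n : ℕ, u x₀ - v x₀ ≤
      u (q n).1 - v (q n).2 - n * ‖(q n).1 - (q n).2‖ ^ 2 - η * ‖(q n).1 - x₀‖ ^ 2 := fun n => by
    simpa [doubled] using hqmax n (show (x₀, x₀) ∈ _ by simp [hρ.le])
  have hdist : Tendsto (fun n => dist (q n).1 (q n).2) atTop (𝓝 0) := by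
    have h1 : Tendsto (fun n : ℕ => 4 * M / (n : ℝ)) atTop (𝓝 0) :=
      tendsto_const_div_atTop_nhds_zero_nat _
    have h2 : Tendsto (fun n => ‖(q n).1 - (q n).2‖ ^ 2) atTop (𝓝 0) := by
      refine squeeze_zero' (Eventually.of_forall fun n => by positivity) ?_ h1
      filter_upwards [eventually_gt_atTop 0] with n hn
      have hn' : (0 : ℝ) < n := by exact_mod_cast hn
      rw [le_div_iff₀ hn']
      have h3 := hbase n
      have h4 : 0 ≤ η * ‖(q n).1 - x₀‖ ^ 2 := by positivity
      linarith [abs_le.1 (hMu x₀), abs_le.1 (hMv x₀), abs_le.1 (hMu (q n).1),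
        abs_le.1 (hMv (q n).2)]
    simpa [dist_eq_norm, Real.sqrt_sq] using h2.sqrt
  have hvdiff : Tendsto (fun n => v (q n).1 - v (q n).2) atTop (𝓝 0) := by
    have h2 : Tendsto q atTop (uniformity (Rd d)) :=
      tendsto_uniformity_iff_dist_tendsto_zero.2 hdist
    have h1 : Tendsto (fun n => dist (v (q n).1) (v (q n).2)) atTop (𝓝 0) :=
      tendsto_uniformity_iff_dist_tendsto_zero (f := fun n => (v (q n).1, v (q n).2)).1
        (Tendsto.comp hv h2)
    exact tendsto_zero_iff_norm_tendsto_zero.2 (by simpa [dist_eq_norm] using h1)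
  have hxlim : Tendsto (fun n => (q n).1) atTop (𝓝 x₀) := by
    rw [tendsto_iff_norm_sub_tendsto_zero]
    have h1 : Tendsto (fun n => ‖(q n).1 - x₀‖ ^ 2) atTop (𝓝 0) := by
      refine squeeze_zero (fun n => by positivity) (fun n => ?_) (by simpa using hvdiff.div_const η)
      rw [le_div_iff₀ hη]
      have h2 := hbase n
      have h3 := hmax _ (hq n).1
      have h4 : 0 ≤ n * ‖(q n).1 - (q n).2‖ ^ 2 := by positivity
      linarith
    simpa [Real.sqrt_sq] using h1.sqrt
  have hylim : Tendsto (fun n => (q n).2) atTop (𝓝 x₀) := by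
    have h := hxlim.sub (tendsto_zero_iff_norm_tendsto_zero.2
      (by simpa [dist_eq_norm] using hdist : Tendsto (fun n => ‖(q n).1 - (q n).2‖) atTop (𝓝 0)))
    simpa using h
  have hineq : ∀ᶠ n in atTop,
      ∫ z in (ball 0 σ)ᶜ, doubledIncr u v x₀ η (q n).1 (q n).2 z * S.j ‖z‖ ≤
        a (q n).1 + b (q n).2 + η * ∫ z : Rd d, min 1 (‖z‖ ^ 2) * S.j ‖z‖ := by
    have hρ2 : 0 < ρ / 2 := by linarith
    filter_upwards [hxlim.eventually (ball_mem_nhds x₀ hρ2),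
      hylim.eventually (ball_mem_nhds x₀ hρ2)] with n hxn hyn
    have hin : ∀ {x z : Rd d}, x ∈ ball x₀ (ρ / 2) → ‖z‖ < ρ / 2 → x + z ∈ closedBall x₀ ρ := by
      intro x z hx hz
      rw [mem_ball, dist_eq_norm] at hx
      rw [mem_closedBall, dist_eq_norm, add_sub_right_comm]
      linarith [norm_add_le (x - x₀) z]
    exact integral_doubledIncr_le hd hu.continuous hv.continuous hMu hMv (Nat.cast_nonneg n) hη.le
      hσ hσ1 (by linarith : σ < ρ / 2) (fun z w hz hw => hqmax n ⟨hin hxn hz, hin hyn hw⟩)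
      (ha _ (hq n).1) (hb _ (hq n).2)
  refine le_of_tendsto_of_tendsto ?_
    (((hac.tendsto.comp hxlim).add (hbc.tendsto.comp hylim)).add_const _) hineq
  refine tendsto_integral_of_dominated_convergence (fun z => (4 * M + 2 * η * ρ) * S.j ‖z‖)
    (fun n => ((measurable_doubledIncr hu.continuous hv.continuous _ _ _ _).mul
      S.measurable_j_norm).aestronglyMeasurable)
    (S.integrableOn_mul_j measurable_const (fun _ => le_rfl) hσ hσ1)
    (fun n => Eventually.of_forall fun z => ?_) (Eventually.of_forall fun z => ?_)
  · rw [norm_mul, Real.norm_of_nonneg (S.j_nonneg _)]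
    refine mul_le_mul_of_nonneg_right ((abs_doubledIncr_le hMu hMv x₀ hη.le _ _ z).trans ?_)
      (S.j_nonneg _)
    have : ‖(q n).1 - x₀‖ ≤ ρ := by simpa [dist_eq_norm] using (hq n).1
    gcongr
  · refine Tendsto.mul_const _ ?_
    have h0 : u x₀ - v x₀ - (u (x₀ + z) - v (x₀ + z)) = doubledIncr u v x₀ η x₀ x₀ z := by
      simp [doubledIncr]
    rw [h0]
    have hcu : ∀ w, Tendsto u (𝓝 w) (𝓝 (u w)) := fun w => hu.continuous.tendsto w
    have hcv : ∀ w, Tendsto v (𝓝 w) (𝓝 (v w)) := fun w => hv.continuous.tendsto w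
    unfold doubledIncr
    refine ((((hcu _).comp hxlim).sub ((hcv _).comp hylim)).sub
      (((hcu _).comp (hxlim.add_const z)).sub ((hcv _).comp (hylim.add_const z)))).add ?_
    split_ifs
    · exact ((hxlim.sub_const x₀).const_smul (2 * η)).inner tendsto_const_nhds
    · exact tendsto_const_nhds

end Doubling

/-! ### Reflections -/

section Reflection

variable {d : ℕ}

lemma inner_reflAt {e : Rd d} (he : ‖e‖ = 1) (lam : ℝ) (x : Rd d) :
    ⟪reflAt e lam x, e⟫ = 2 * lam - ⟪x, e⟫ := by
  simp only [reflAt, inner_sub_left, real_inner_smul_left, real_inner_self_eq_norm_sq, he]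
  ring

lemma reflAt_reflAt {e : Rd d} (he : ‖e‖ = 1) (lam : ℝ) (x : Rd d) :
    reflAt e lam (reflAt e lam x) = x := by
  conv_lhs => rw [reflAt, inner_reflAt he]
  rw [reflAt, sub_sub, ← add_smul]
  ring_nf
  simp

lemma norm_reflAt_sub_sq {e : Rd d} (he : ‖e‖ = 1) (lam : ℝ) (x y : Rd d) :
    ‖reflAt e lam x - y‖ ^ 2 = ‖x - y‖ ^ 2 + 4 * (⟪x, e⟫ - lam) * (⟪y, e⟫ - lam) := by
  have h : reflAt e lam x - y = (x - y) - (2 * ⟪x, e⟫ - 2 * lam) • e := by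
    simp only [reflAt]; abel
  rw [h, norm_sub_sq_real, norm_smul, he, real_inner_smul_right, inner_sub_left, mul_one,
    Real.norm_eq_abs, sq_abs]
  ring

lemma norm_reflAt_sq {e : Rd d} (he : ‖e‖ = 1) (lam : ℝ) (x : Rd d) :
    ‖reflAt e lam x‖ ^ 2 = ‖x‖ ^ 2 - 4 * (⟪x, e⟫ - lam) * lam := by
  have h := norm_reflAt_sub_sq he lam x 0
  simp only [sub_zero, inner_zero_left] at h
  rw [h]; ring

lemma norm_sub_lt_norm_reflAt_sub {e : Rd d} (he : ‖e‖ = 1) {lam : ℝ} {x y : Rd d}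
    (hx : x ∈ halfSpace e lam) (hy : y ∈ halfSpace e lam) : ‖x - y‖ < ‖reflAt e lam x - y‖ := by
  refine lt_of_pow_lt_pow_left₀ 2 (norm_nonneg _) ?_
  rw [norm_reflAt_sub_sq he]
  have hx' : lam < ⟪x, e⟫ := hx
  have hy' : lam < ⟪y, e⟫ := hy
  have := mul_pos (sub_pos.2 hx') (sub_pos.2 hy')
  linarith

lemma reflAt_eq_reflection_add {e : Rd d} (he : ‖e‖ = 1) (lam : ℝ) (x : Rd d) :
    reflAt e lam x = (ℝ ∙ e)ᗮ.reflection x + (2 * lam) • e := by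
  rw [Submodule.reflection_orthogonal_apply, Submodule.reflection_singleton_apply, he, reflAt,
    real_inner_comm, sub_smul, mul_smul, two_smul, two_smul]
  simp only [RCLike.ofReal_real_eq_id, id_eq, one_pow, div_one, mul_smul, two_smul]
  abel

lemma measurePreserving_reflAt {e : Rd d} (he : ‖e‖ = 1) (lam : ℝ) :
    MeasurePreserving (reflAt e lam) := by
  have h : reflAt e lam = (fun y => y + (2 * lam) • e) ∘ (ℝ ∙ e)ᗮ.reflection :=
    funext fun x => reflAt_eq_reflection_add he lam x
  rw [h]
  exact (measurePreserving_add_right volume _).comp (ℝ ∙ e)ᗮ.reflection.measurePreserving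

lemma continuous_reflAt (e : Rd d) (lam : ℝ) : Continuous (reflAt e lam) := by
  unfold reflAt
  fun_prop

lemma isometry_reflAt {e : Rd d} (he : ‖e‖ = 1) (lam : ℝ) : Isometry (reflAt e lam) :=
  Isometry.of_dist_eq fun x y => by
    rw [reflAt_eq_reflection_add he, reflAt_eq_reflection_add he, dist_add_right,
      LinearIsometryEquiv.dist_map]

lemma isOpen_halfSpace (e : Rd d) (lam : ℝ) : IsOpen (halfSpace e lam) :=
  isOpen_lt continuous_const (by fun_prop)

lemma measurableEmbedding_reflAt {e : Rd d} (he : ‖e‖ = 1) (lam : ℝ) :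
    MeasurableEmbedding (reflAt e lam) :=
  (isometry_reflAt he lam).isClosedEmbedding.measurableEmbedding

/-- If an antisymmetric function with a nonnegative maximum over the half-space at `x₀` had a
smaller value in the half-space, the nonlocal operator at `x₀` would be positive. -/
lemma eq_of_setIntegral_le_zero (hd : 0 < d) (S : PsiSetting d) {e : Rd d} (he : ‖e‖ = 1)
    {lam : ℝ} {g : Rd d → ℝ} (hg : Continuous g) {C : ℝ} (hC : ∀ x, |g x| ≤ C)
    (hanti : AntiSym e lam g) {x₀ : Rd d} (hx₀ : x₀ ∈ halfSpace e lam)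
    (hmax : ∀ x ∈ halfSpace e lam, g x ≤ g x₀) (hm : 0 ≤ g x₀)
    (hInt : ∀ᶠ σ in 𝓝[>] (0 : ℝ),
      ∫ z in (ball 0 σ)ᶜ, (g x₀ - g (x₀ + z)) * S.j ‖z‖ ≤ 0) :
    ∀ x ∈ halfSpace e lam, g x = g x₀ := by
  intro y₁ hy₁
  by_contra hne
  have hlt : g y₁ < g x₀ := lt_of_le_of_ne (hmax y₁ hy₁) hne
  have hC0 : 0 ≤ C := (abs_nonneg _).trans (hC x₀)
  have hRg : ∀ y, g (reflAt e lam y) = -g y := fun y => by rw [hanti y, neg_neg]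
  obtain ⟨G, hG₁, hG₂⟩ := exists_between hlt
  obtain ⟨t₁, ht₁, ht₁'⟩ := exists_between (norm_sub_lt_norm_reflAt_sub he hy₁ hx₀)
  obtain ⟨t₂, ht₁₂, ht₂⟩ := exists_between ht₁'
  have hy₁₀ : 0 < ‖y₁ - x₀‖ := norm_pos_iff.2 (sub_ne_zero.2 fun h => hne (by rw [h]))
  obtain ⟨σ₀, hσ₀, hσ₀'⟩ := exists_between hy₁₀
  have ht₁0 : 0 < t₁ := hy₁₀.trans ht₁
  have hRc := continuous_reflAt e lam
  obtain ⟨τ, hτ, hW⟩ : ∃ τ > 0, ∀ y ∈ ball y₁ τ, y ∈ halfSpace e lam ∧ g y < G ∧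
      ‖y - x₀‖ < t₁ ∧ t₂ < ‖reflAt e lam y - x₀‖ ∧ σ₀ < ‖y - x₀‖ := by
    refine Metric.eventually_nhds_iff_ball.1 ?_
    filter_upwards [(isOpen_halfSpace e lam).mem_nhds hy₁,
      hg.continuousAt.eventually_lt continuousAt_const hG₁,
      ContinuousAt.eventually_lt (f := fun y => ‖y - x₀‖) (by fun_prop) continuousAt_const ht₁,
      ContinuousAt.eventually_lt (g := fun y => ‖reflAt e lam y - x₀‖) continuousAt_const
        (by fun_prop) ht₂,
      ContinuousAt.eventually_lt (g := fun y => ‖y - x₀‖) continuousAt_const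
        (by fun_prop) hσ₀'] with y h1 h2 h3 h4 h5
    exact ⟨h1, h2, h3, h4, h5⟩
  set c := (g x₀ - G) * (S.j t₁ - S.j t₂) with hc
  have hjt : 0 < S.j t₁ - S.j t₂ := sub_pos.2 (S.j_lt hd ht₁0 ht₁₂)
  have hcpos : 0 < c := mul_pos (sub_pos.2 hG₂) hjt
  set D := ⟪x₀, e⟫ - lam with hD
  have hDpos : 0 < D := sub_pos.2 hx₀
  have hj_anti : ∀ {s t : ℝ}, 0 < s → s ≤ t → S.j t ≤ S.j s := fun hs hst =>
    hst.eq_or_lt.elim (fun h => by rw [h]) fun h => (S.j_lt hd hs h).le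
  have hRD : ∀ y ∈ halfSpace e lam, D ≤ ‖reflAt e lam y - x₀‖ := by
    intro y hy
    have h1 : ⟪x₀ - reflAt e lam y, e⟫ ≤ ‖x₀ - reflAt e lam y‖ * ‖e‖ := real_inner_le_norm _ _
    rw [inner_sub_left, inner_reflAt he, he, mul_one, norm_sub_rev] at h1
    have h2 : lam < ⟪y, e⟫ := hy
    linarith
  set E := C * S.j D with hE
  have hE0 : 0 ≤ E := mul_nonneg hC0 (S.j_nonneg D)
  have hkey : ∀ᶠ σ in 𝓝[>] (0 : ℝ), c * volume.real (ball y₁ τ) ≤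
      2 * E * volume.real (ball (0 : Rd d) σ) := by
    filter_upwards [hInt, Ioo_mem_nhdsGT (lt_min hσ₀ one_pos)] with σ hσint ⟨hσ, hσlt⟩
    have hσσ₀ : σ < σ₀ := hσlt.trans_le (min_le_left _ _)
    have hσ1 : σ ≤ 1 := hσlt.le.trans (min_le_right _ _)
    have hmc : MeasurableSet (ball (0 : Rd d) σ)ᶜ := measurableSet_ball.compl
    set h : Rd d → ℝ := (ball 0 σ)ᶜ.indicator fun z => (g x₀ - g (x₀ + z)) * S.j ‖z‖ with hh
    have hhint : Integrable h := by
      rw [hh, integrable_indicator_iff hmc]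
      refine S.integrableOn_mul_j (C := 2 * C) ?_ (fun z => ?_) hσ hσ1
      · have := hg.measurable
        fun_prop
      · linarith [abs_sub (g x₀) (g (x₀ + z)), hC x₀, hC (x₀ + z)]
    have hh0 : ∫ z, h z ≤ 0 := by rwa [hh, integral_indicator hmc]
    set F : Rd d → ℝ := fun y => h (y - x₀) with hF
    have hFint : Integrable F := hhint.comp_sub_right x₀
    have hF0 : ∫ y, F y ≤ 0 := (integral_sub_right_eq_self h x₀).trans_le hh0
    have hR := measurePreserving_reflAt he lam
    have hRe := measurableEmbedding_reflAt he lam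
    have hFRint : Integrable fun y => F (reflAt e lam y) := (hR.integrable_comp_emb hRe).2 hFint
    have hFR0 : ∫ y, F (reflAt e lam y) ≤ 0 := (hR.integral_comp hRe F).trans_le hF0
    have hFnear : ∀ y, ‖y - x₀‖ < σ → F y = 0 := fun y hy =>
      indicator_of_notMem (by simpa using hy) _
    have hFfar : ∀ y, σ ≤ ‖y - x₀‖ → F y = (g x₀ - g y) * S.j ‖y - x₀‖ := fun y hy => by
      simp only [hF, hh]
      rw [indicator_of_mem (by simpa using hy), add_sub_cancel]
    have hballR : ∀ y, (ball x₀ σ).indicator (fun _ => E) y ≥ 0 := fun y =>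
      indicator_nonneg (fun _ _ => hE0) y
    have hhalf : ∀ y ∈ halfSpace e lam, (ball y₁ τ).indicator (fun _ => c) y -
        (ball x₀ σ).indicator (fun _ => E) y ≤ F y + F (reflAt e lam y) := by
      intro y hy
      have hyR := norm_sub_lt_norm_reflAt_sub he hy hx₀
      rcases lt_or_ge ‖y - x₀‖ σ with h1 | h1
      · have hyW : y ∉ ball y₁ τ := fun hyW => by linarith [(hW y hyW).2.2.2.2]
        rw [indicator_of_notMem hyW, indicator_of_mem (by simpa [dist_eq_norm] using h1),
          hFnear y h1, zero_sub, zero_add]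
        rcases lt_or_ge ‖reflAt e lam y - x₀‖ σ with h2 | h2
        · rw [hFnear _ h2]; linarith
        · rw [hFfar _ h2, hRg]
          have h3 := hj_anti hDpos (hRD y hy)
          have h4 := S.j_nonneg ‖reflAt e lam y - x₀‖
          have h5 := mul_le_mul_of_nonneg_left h3 hC0
          have h6 : -C ≤ g x₀ - -g y := by linarith [(abs_le.1 (hC y)).1]
          have h7 := mul_le_mul_of_nonneg_right h6 h4
          linarith
      · have hyσ : y ∉ ball x₀ σ := by simpa [dist_eq_norm] using h1
        rw [indicator_of_notMem hyσ, sub_zero, hFfar y h1, hFfar _ (h1.trans hyR.le), hRg]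
        have hy0 : 0 < ‖y - x₀‖ := hσ.trans_le h1
        have h2 : (g x₀ - g y) * (S.j ‖y - x₀‖ - S.j ‖reflAt e lam y - x₀‖) ≤
            (g x₀ - g y) * S.j ‖y - x₀‖ + (g x₀ - -g y) * S.j ‖reflAt e lam y - x₀‖ := by
          nlinarith [mul_nonneg hm (S.j_nonneg ‖reflAt e lam y - x₀‖)]
        refine le_trans ?_ h2
        by_cases hyW : y ∈ ball y₁ τ
        · obtain ⟨-, h3, h4, h5, -⟩ := hW y hyW
          rw [indicator_of_mem hyW]
          refine mul_le_mul (by linarith) ?_ hjt.le (by linarith [hmax y hy])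
          exact sub_le_sub (hj_anti hy0 h4.le) (hj_anti (ht₁0.trans ht₁₂) h5.le)
        · rw [indicator_of_notMem hyW]
          exact mul_nonneg (sub_nonneg.2 (hmax y hy)) (sub_nonneg.2 (S.j_lt hd hy0 hyR).le)
    have hlow : ∀ y, (ball y₁ τ).indicator (fun _ => c) y -
        (ball x₀ σ).indicator (fun _ => E) y -
        (ball x₀ σ).indicator (fun _ => E) (reflAt e lam y) ≤ F y + F (reflAt e lam y) := by
      intro y
      rcases lt_or_ge lam ⟪y, e⟫ with h1 | h1
      · linarith [hhalf y h1, hballR (reflAt e lam y)]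
      · rw [indicator_of_notMem (s := ball y₁ τ) fun hy => not_lt.2 h1 (hW y hy).1]
        rcases h1.lt_or_eq with h2 | h2
        · have h3 := hhalf (reflAt e lam y) (by
            change lam < _
            rw [inner_reflAt he]; linarith)
          rw [reflAt_reflAt he] at h3
          have h4 : (ball y₁ τ).indicator (fun _ => c) (reflAt e lam y) ≥ 0 :=
            indicator_nonneg (fun _ _ => hcpos.le) _
          linarith [hballR y]
        · have h3 : reflAt e lam y = y := by simp [reflAt, h2]
          have h4 : g y = 0 := by linarith [h3 ▸ hRg y]
          have h5 : 0 ≤ F y := by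
            rcases lt_or_ge ‖y - x₀‖ σ with h6 | h6
            · rw [hFnear y h6]
            · rw [hFfar y h6, h4, sub_zero]
              exact mul_nonneg hm (S.j_nonneg _)
          rw [h3]
          linarith [hballR y]
    have hiW : Integrable ((ball y₁ τ).indicator fun _ => c) :=
      (integrableOn_const measure_ball_lt_top.ne).integrable_indicator measurableSet_ball
    have hiE : Integrable ((ball x₀ σ).indicator fun _ => E) :=
      (integrableOn_const measure_ball_lt_top.ne).integrable_indicator measurableSet_ball
    have hiER : Integrable fun y => (ball x₀ σ).indicator (fun _ => E) (reflAt e lam y) :=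
      (hR.integrable_comp_emb hRe).2 hiE
    have hiWE : Integrable fun y => (ball y₁ τ).indicator (fun _ => c) y -
        (ball x₀ σ).indicator (fun _ => E) y := hiW.sub hiE
    have hle := integral_mono (hiWE.sub hiER) (hFint.add hFRint) hlow
    simp only [Pi.sub_apply, Pi.add_apply] at hle
    rw [integral_sub hiWE hiER, integral_sub hiW hiE, integral_add hFint hFRint,
      hR.integral_comp hRe ((ball x₀ σ).indicator fun _ => E),
      integral_indicator_const _ measurableSet_ball,
      integral_indicator_const _ measurableSet_ball, smul_eq_mul, smul_eq_mul] at hle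
    have hvol : volume.real (ball x₀ σ) = volume.real (ball (0 : Rd d) σ) := by
      simp only [measureReal_def, Measure.addHaar_ball_center]
    rw [hvol] at hle
    linarith
  have hvol0 : Tendsto (fun σ : ℝ => volume.real (ball (0 : Rd d) σ)) (𝓝[>] 0) (𝓝 0) := by
    have h1 : Tendsto (fun σ : ℝ => σ ^ d * volume.real (ball (0 : Rd d) 1)) (𝓝[>] 0) (𝓝 0) := by
      have h2 : Tendsto (fun σ : ℝ => σ ^ d * volume.real (ball (0 : Rd d) 1)) (𝓝 0)
          (𝓝 ((0 : ℝ) ^ d * volume.real (ball (0 : Rd d) 1))) :=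
        Continuous.tendsto (by fun_prop) 0
      rw [zero_pow hd.ne', zero_mul] at h2
      exact h2.mono_left nhdsWithin_le_nhds
    refine h1.congr' ?_
    filter_upwards [self_mem_nhdsWithin] with σ hσ
    have h3 := Measure.addHaar_ball_of_pos (volume : Measure (Rd d)) 0 hσ
    have hσ' : (0 : ℝ) ≤ σ ^ d := pow_nonneg (le_of_lt hσ) d
    simp [measureReal_def, h3, ENNReal.toReal_mul, hσ']
  have hfin := ge_of_tendsto (hvol0.const_mul (2 * E)) hkey
  rw [mul_zero] at hfin
  have hWpos : 0 < volume.real (ball y₁ τ) :=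
    ENNReal.toReal_pos (measure_ball_pos volume y₁ hτ).ne' measure_ball_lt_top.ne
  exact absurd (mul_pos hcpos hWpos) (not_lt.2 hfin)

/-- Strong maximum principle for antisymmetric functions. -/
lemma eq_zero_of_setIntegral_le_zero (hd : 0 < d) (S : PsiSetting d) {e : Rd d} (he : ‖e‖ = 1)
    {lam : ℝ} {g : Rd d → ℝ} (hg : Continuous g) {C : ℝ} (hC : ∀ x, |g x| ≤ C)
    (hanti : AntiSym e lam g) {x₀ : Rd d} (hx₀ : x₀ ∈ halfSpace e lam)
    (hmax : ∀ x ∈ halfSpace e lam, g x ≤ g x₀) (hm : 0 ≤ g x₀)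
    (hInt : ∀ᶠ σ in 𝓝[>] (0 : ℝ),
      ∫ z in (ball 0 σ)ᶜ, (g x₀ - g (x₀ + z)) * S.j ‖z‖ ≤ 0) :
    ∀ x ∈ halfSpace e lam, g x = 0 := by
  have hconst := eq_of_setIntegral_le_zero hd S he hg hC hanti hx₀ hmax hm hInt
  set p : ℝ → Rd d := fun t => x₀ - (t * (⟪x₀, e⟫ - lam)) • e with hp
  have hpe : ∀ t, ⟪p t, e⟫ = ⟪x₀, e⟫ - t * (⟪x₀, e⟫ - lam) := fun t => by
    simp [hp, inner_sub_left, real_inner_smul_left, he]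
  have hp1 : g (p 1) = 0 := by
    have h1 : reflAt e lam (p 1) = p 1 := by simp [reflAt, hpe]
    have h2 := hanti (p 1)
    rw [h1] at h2
    linarith
  have hlim : Tendsto (fun t => g (p t)) (𝓝[<] 1) (𝓝 (g (p 1))) :=
    ((hg.comp (by fun_prop)).tendsto 1).mono_left nhdsWithin_le_nhds
  have hlim' : Tendsto (fun t => g (p t)) (𝓝[<] 1) (𝓝 (g x₀)) := by
    refine tendsto_const_nhds.congr' ?_
    filter_upwards [self_mem_nhdsWithin] with t ht
    refine (hconst _ ?_).symm
    change lam < _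
    rw [hpe]
    have h1 : 0 < (1 - t) * (⟪x₀, e⟫ - lam) := mul_pos (sub_pos.2 ht) (sub_pos.2 hx₀)
    linarith
  intro x hx
  rw [hconst x hx, ← hp1]
  exact tendsto_nhds_unique hlim' hlim

end Reflection

/-! ### Comparison with reflections -/

section Comparison

variable {d : ℕ} {S : PsiSetting d} {r A : ℝ} {f : ℝ → ℝ} {u : Rd d → ℝ}

lemma IsSol.subAt {Ω : Set (Rd d)} {g : Rd d → ℝ} (h : IsSol S Ω (fun _ => 0) g u) {x : Rd d}
    (hx : x ∈ Ω) : SubAt S u x (g x) := fun φ hφ hφx hφlt => by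
  simpa using h.1.2 x hx φ hφ hφx hφlt

lemma IsSol.subAt_neg {Ω : Set (Rd d)} {g : Rd d → ℝ} (h : IsSol S Ω (fun _ => 0) g u) {x : Rd d}
    (hx : x ∈ Ω) : SubAt S (fun y => -u y) x (-g x) := by
  rintro φ ⟨⟨M, hM⟩, hφc, U, hU, hφU⟩ hφx hφlt
  have h1 := h.2.2 x hx (fun y => -φ y)
    ⟨⟨M, fun y => (abs_neg _).trans_le (hM y)⟩, hφc.neg, U, hU, hφU.neg⟩ (by simp [hφx])
    fun y hy => neg_lt.1 (hφlt y hy)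
  rw [psiOp_neg] at h1
  linarith

/-- A solution whose difference with its reflection attains a nonnegative maximum over the
half-space at a point where both equations hold is symmetric. -/
lemma eq_reflAt_of_isMax (hd : 0 < d) (hf : ContinuousOn f (Icc 0 A))
    (hmono : AntitoneOn f (Icc 0 A)) (hu : UniformContinuous u)
    (hsol : IsSol S (closedBall 0 r)ᶜ (fun _ => 0) (fun x => f (u x)) u)
    (hbound : ∀ x, 0 ≤ u x ∧ u x ≤ A) {e : Rd d} (he : ‖e‖ = 1) {lam : ℝ} {x₀ : Rd d}
    (hx₀ : x₀ ∈ halfSpace e lam) (hx₀r : x₀ ∈ (closedBall (0 : Rd d) r)ᶜ)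
    (hRx₀r : reflAt e lam x₀ ∈ (closedBall (0 : Rd d) r)ᶜ)
    (hle : u (reflAt e lam x₀) ≤ u x₀)
    (hmax : ∀ x ∈ halfSpace e lam, u x - u (reflAt e lam x) ≤ u x₀ - u (reflAt e lam x₀)) :
    ∀ x ∈ halfSpace e lam, u x = u (reflAt e lam x) := by
  have hM : ∀ x, |u x| ≤ A := fun x => (abs_of_nonneg (hbound x).1).trans_le (hbound x).2
  have hRc := continuous_reflAt e lam
  have huc := hu.continuous
  have hfu : Continuous fun x => f (u x) := hf.comp_continuous huc hbound
  have hopen : IsOpen (closedBall (0 : Rd d) r)ᶜ := isClosed_closedBall.isOpen_compl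
  have hv : UniformContinuous fun x => u (reflAt e lam x) :=
    hu.comp (isometry_reflAt he lam).uniformContinuous
  obtain ⟨ρ, hρ, hball⟩ : ∃ ρ > 0, ∀ x ∈ closedBall x₀ ρ, x ∈ halfSpace e lam ∧
      x ∈ (closedBall (0 : Rd d) r)ᶜ ∧ reflAt e lam x ∈ (closedBall (0 : Rd d) r)ᶜ := by
    refine (nhds_basis_closedBall (x := x₀)).eventually_iff.1 ?_
    filter_upwards [(isOpen_halfSpace e lam).mem_nhds hx₀, hopen.mem_nhds hx₀r,
      (hopen.preimage hRc).mem_nhds hRx₀r] with x h1 h2 h3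
    exact ⟨h1, h2, h3⟩
  have hsub : ∀ x ∈ closedBall x₀ ρ, ParabSubAt S u x (f (u x)) := fun x hx =>
    (hsol.subAt (hball x hx).2.1).parabSubAt huc hM
  have hsup : ∀ x ∈ closedBall x₀ ρ,
      ParabSubAt S (fun y => -u (reflAt e lam y)) x (-f (u (reflAt e lam x))) := by
    intro x hx
    have h1 := (hsol.subAt_neg (hball x hx).2.2).parabSubAt huc.neg
      fun y => (abs_neg _).trans_le (hM y)
    rw [reflAt_eq_reflection_add he] at h1
    have h2 := h1.comp_isometry
    simpa only [← reflAt_eq_reflection_add he] using h2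
  have hanti : AntiSym e lam fun x => u x - u (reflAt e lam x) := fun x => by
    simp only [reflAt_reflAt he]; ring
  have hfv : Continuous fun x => -f (u (reflAt e lam x)) := (hfu.comp hRc).neg
  have hgc : Continuous fun x => u x - u (reflAt e lam x) := huc.sub hv.continuous
  have hzero := eq_zero_of_setIntegral_le_zero hd S he (C := 2 * A) hgc
    (fun x => by linarith [abs_sub (u x) (u (reflAt e lam x)), hM x, hM (reflAt e lam x)])
    hanti hx₀ hmax (sub_nonneg.2 hle) (by
      filter_upwards [Ioo_mem_nhdsGT (lt_min (by positivity : 0 < ρ / 2) one_pos)]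
        with σ ⟨hσ, hσlt⟩
      have h1 := setIntegral_sub_le_of_isLocalMax hd hu hv hM (fun y => hM _) hσ
        (hσlt.le.trans (min_le_right _ _)) (by linarith [hσlt.trans_le (min_le_left _ _)])
        (fun x hx => hmax x (hball x hx).1) hfu.continuousAt
        hfv.continuousAt hsub hsup
      refine h1.trans ?_
      have h2 := hmono (hbound _) (hbound _) hle
      linarith)
  exact fun x hx => sub_eq_zero.1 (hzero x hx)

/-- The moving plane inequality. -/
lemma le_reflAt (hd : 0 < d) (hf : ContinuousOn f (Icc 0 A))
    (hmono : AntitoneOn f (Icc 0 A)) (hu : UniformContinuous u)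
    (hsol : IsSol S (closedBall 0 r)ᶜ (fun _ => 0) (fun x => f (u x)) u)
    (hball : ∀ x ∈ closedBall (0 : Rd d) r, u x = A)
    (hbound : ∀ x, 0 ≤ u x ∧ u x ≤ A) (hdecay : Tendsto u (cocompact (Rd d)) (𝓝 0))
    {e : Rd d} (he : ‖e‖ = 1) {lam : ℝ} (hlam : 0 ≤ lam) {x : Rd d}
    (hx : x ∈ halfSpace e lam) : u x ≤ u (reflAt e lam x) := by
  by_contra! hlt
  set g : Rd d → ℝ := fun y => u y - u (reflAt e lam y) with hg
  have hgc : Continuous g := hu.continuous.sub (hu.continuous.comp (continuous_reflAt e lam))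
  have hglim : Tendsto g (cocompact (Rd d)) (𝓝 0) := by
    simpa using hdecay.sub
      (hdecay.comp (isometry_reflAt he lam).isClosedEmbedding.tendsto_cocompact)
  have hclosed : IsClosed {y : Rd d | lam ≤ ⟪y, e⟫} := isClosed_le continuous_const (by fun_prop)
  have hsubset : ∀ y ∈ halfSpace e lam, y ∈ {y : Rd d | lam ≤ ⟪y, e⟫} := fun y hy =>
    le_of_lt (show lam < ⟪y, e⟫ from hy)
  obtain ⟨x₀, hx₀, hmax⟩ := hgc.continuousOn.exists_isMaxOn' hclosed (hsubset x hx)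
    ((hglim.eventually_lt_const (sub_pos.2 hlt)).filter_mono inf_le_left |>.mono
      fun y hy => le_of_lt hy)
  have hgx₀ : 0 < g x₀ := (sub_pos.2 hlt).trans_le (hmax (hsubset x hx))
  have hx₀' : lam ≤ ⟪x₀, e⟫ := hx₀
  have hx₀H : x₀ ∈ halfSpace e lam := by
    refine lt_of_le_of_ne hx₀' fun h => hgx₀.ne' ?_
    simp [hg, reflAt, ← h]
  have hltx₀ : u (reflAt e lam x₀) < u x₀ := sub_pos.1 hgx₀
  have hRx₀r : reflAt e lam x₀ ∉ closedBall (0 : Rd d) r := fun h => by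
    linarith [hball _ h, (hbound x₀).2]
  have hnorm : ‖reflAt e lam x₀‖ ≤ ‖x₀‖ := by
    refine (sq_le_sq₀ (norm_nonneg _) (norm_nonneg _)).1 ?_
    rw [norm_reflAt_sq he]
    have := mul_nonneg (sub_nonneg.2 hx₀') hlam
    linarith
  have hx₀r : x₀ ∉ closedBall (0 : Rd d) r := fun h => hRx₀r <| by
    rw [mem_closedBall_zero_iff] at h ⊢
    exact hnorm.trans h
  have := eq_reflAt_of_isMax hd hf hmono hu hsol hbound he hx₀H hx₀r hRx₀r hltx₀.le
    (fun y hy => hmax (hsubset y hy)) x hx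
  exact hlt.ne' this

/-- A continuous radial function decaying at infinity and positive at the origin is not symmetric
with respect to a hyperplane not passing through the origin. -/
lemma exists_ne_reflAt (hrad : ∀ x y : Rd d, ‖x‖ = ‖y‖ → u x = u y) (h0 : 0 < u 0)
    (hdecay : Tendsto u (cocompact (Rd d)) (𝓝 0)) {e : Rd d} (he : ‖e‖ = 1) {lam : ℝ}
    (hlam : 0 < lam) : ∃ x ∈ halfSpace e lam, u x ≠ u (reflAt e lam x) := by
  by_contra! h
  have hall : ∀ k : ℕ, u ((2 * k * lam) • e) = u 0 := by
    intro k
    induction k with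
    | zero => simp
    | succ k ih =>
      rw [h, ← ih]
      · refine hrad _ _ ?_
        rw [show reflAt e lam ((2 * ((k + 1 : ℕ) : ℝ) * lam) • e) = -((2 * k * lam) • e) from ?_,
          norm_neg]
        rw [reflAt, real_inner_smul_left, real_inner_self_eq_norm_sq, he, ← sub_smul, ← neg_smul]
        push_cast
        ring_nf
      · change lam < _
        rw [real_inner_smul_left, real_inner_self_eq_norm_sq, he]
        push_cast
        nlinarith [mul_nonneg (Nat.cast_nonneg (α := ℝ) k) hlam.le]
  have hnorm : Tendsto (fun k : ℕ => ‖(2 * k * lam) • e‖) atTop atTop := by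
    have h1 : (fun k : ℕ => ‖(2 * k * lam) • e‖) = fun k : ℕ => (k : ℝ) * (2 * lam) := by
      ext k
      rw [norm_smul, he, Real.norm_of_nonneg (by positivity)]
      ring
    rw [h1]
    exact tendsto_natCast_atTop_atTop.atTop_mul_const (by positivity)
  have hcoc : Tendsto (fun k : ℕ => (2 * k * lam) • e) atTop (cocompact (Rd d)) := by
    rw [← Metric.cobounded_eq_cocompact]
    exact tendsto_norm_atTop_iff_cobounded.1 hnorm
  have h2 := hdecay.comp hcoc
  have h3 : u 0 = 0 := tendsto_nhds_unique
    (tendsto_const_nhds.congr fun k => (hall k).symm) h2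
  exact h0.ne' h3

/-- The hyperplane of symmetry between two points, with its unit normal pointing to `y`. -/
lemma exists_reflAt_eq {x y : Rd d} (hne : x ≠ y) : ∃ e : Rd d, ∃ lam : ℝ, ‖e‖ = 1 ∧
    2 * ‖y - x‖ * lam = ‖y‖ ^ 2 - ‖x‖ ^ 2 ∧ y ∈ halfSpace e lam ∧ reflAt e lam y = x := by
  have hn : 0 < ‖y - x‖ := norm_pos_iff.2 (sub_ne_zero.2 hne.symm)
  set n := ‖y - x‖ with hnd
  have hinner : ⟪y, n⁻¹ • (y - x)⟫ = n⁻¹ * (‖y‖ ^ 2 - ⟪y, x⟫) := by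
    rw [real_inner_smul_right, inner_sub_right, real_inner_self_eq_norm_sq]
  have hsq : n ^ 2 = ‖y‖ ^ 2 - 2 * ⟪y, x⟫ + ‖x‖ ^ 2 := norm_sub_sq_real y x
  have hdiff : ⟪y, n⁻¹ • (y - x)⟫ - (‖y‖ ^ 2 - ‖x‖ ^ 2) / (2 * n) = n / 2 := by
    rw [hinner]
    field_simp
    linarith
  refine ⟨n⁻¹ • (y - x), (‖y‖ ^ 2 - ‖x‖ ^ 2) / (2 * n), ?_, by field_simp, ?_, ?_⟩
  · rw [norm_smul, norm_inv, norm_norm, inv_mul_cancel₀ hn.ne']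
  · change _ < ⟪y, n⁻¹ • (y - x)⟫
    linarith
  · rw [reflAt, ← mul_sub, hdiff, smul_smul]
    field_simp
    simp

end Comparison

/-- **Corollary** (exterior of a ball): any Hölder continuous solution of
`Ψ(−Δ)u = f(u)` outside `closure(B_r(0))` with `u = A` on `closure(B_r(0))`,
`0 ≤ u ≤ A`, decay at infinity, and `f` Lipschitz and non-increasing on
`[0,A]`, is radially symmetric and strictly radially decreasing. -/
theorem radial_symmetry_exterior_ball
    {d : ℕ} (hd : 2 ≤ d) (S : PsiSetting d) (hker : S.kernelCond)
    (r A : ℝ) (hr : 0 < r) (hA : 0 < A)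
    (f : ℝ → ℝ) (hf : ∃ L : ℝ≥0, LipschitzOnWith L f (Set.Icc 0 A))
    (hmono : AntitoneOn f (Set.Icc 0 A))
    (u : Rd d → ℝ)
    (hHolder : ∃ (β : ℝ) (C : ℝ), 0 < β ∧ β ≤ 1 ∧ 0 < C ∧
      ∀ x y, |u x - u y| ≤ C * ‖x - y‖ ^ β)
    (hsol : IsSol S ((Metric.closedBall (0 : Rd d) r)ᶜ)
      (fun _ => 0) (fun x => f (u x)) u)
    (hball : ∀ x ∈ Metric.closedBall (0 : Rd d) r, u x = A)
    (hbound : ∀ x, 0 ≤ u x ∧ u x ≤ A)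
    (hdecay : Filter.Tendsto u (Filter.cocompact (Rd d)) (nhds 0)) :
    (∀ x y : Rd d, ‖x‖ = ‖y‖ → u x = u y) ∧
      (∀ x y : Rd d, r ≤ ‖x‖ → ‖x‖ < ‖y‖ → u y < u x) := by
  have hd0 : 0 < d := by omega
  obtain ⟨L, hL⟩ := hf
  have hfc : ContinuousOn f (Icc 0 A) := hL.continuousOn
  have hu : UniformContinuous u := by
    obtain ⟨β, C, hβ, -, hC, hH⟩ := hHolder
    have hlim : Tendsto (fun t : ℝ => C * t ^ β) (𝓝 0) (𝓝 0) := by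
      have h1 : Tendsto (fun t : ℝ => C * t ^ β) (𝓝 0) (𝓝 (C * 0 ^ β)) :=
        (Real.continuousAt_rpow_const 0 β (Or.inr hβ.le)).tendsto.const_mul C
      rwa [Real.zero_rpow hβ.ne', mul_zero] at h1
    rw [Metric.uniformContinuous_iff]
    intro ε hε
    obtain ⟨δ, hδ, hlt⟩ := Metric.eventually_nhds_iff.1 (hlim.eventually_lt_const hε)
    refine ⟨δ, hδ, fun {x y} hxy => ?_⟩
    rw [Real.dist_eq]
    refine (hH x y).trans_lt (hlt ?_)
    rwa [Real.dist_0_eq_abs, abs_norm, ← dist_eq_norm]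
  have hle : ∀ x y : Rd d, ‖x‖ ≤ ‖y‖ → u y ≤ u x := by
    intro x y hxy
    rcases eq_or_ne x y with rfl | hne
    · exact le_rfl
    obtain ⟨e, lam, he, hlam, hyH, hRy⟩ := exists_reflAt_eq hne
    have hn : 0 < 2 * ‖y - x‖ := mul_pos two_pos (norm_pos_iff.2 (sub_ne_zero.2 hne.symm))
    have hlam0 : 0 ≤ lam := by
      refine nonneg_of_mul_nonneg_right (b := lam) ?_ hn
      rw [hlam]
      exact sub_nonneg.2 (pow_le_pow_left₀ (norm_nonneg x) hxy 2)
    have h := le_reflAt hd0 hfc hmono hu hsol hball hbound hdecay he hlam0 hyH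
    rwa [hRy] at h
  have hrad : ∀ x y : Rd d, ‖x‖ = ‖y‖ → u x = u y := fun x y hxy =>
    le_antisymm (hle y x hxy.ge) (hle x y hxy.le)
  have hstrict : ∀ x y : Rd d, r < ‖x‖ → ‖x‖ < ‖y‖ → u y < u x := by
    intro x y hx hxy
    refine lt_of_le_of_ne (hle x y hxy.le) fun heq => ?_
    have hne : x ≠ y := fun h => hxy.ne (by rw [h])
    obtain ⟨e, lam, he, hlam, hyH, hRy⟩ := exists_reflAt_eq hne
    have hn : 0 < 2 * ‖y - x‖ := mul_pos two_pos (norm_pos_iff.2 (sub_ne_zero.2 hne.symm))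
    have hlam0 : 0 < lam := by
      refine pos_of_mul_pos_right (a := 2 * ‖y - x‖) ?_ hn.le
      rw [hlam]
      exact sub_pos.2 (pow_lt_pow_left₀ hxy (norm_nonneg x) two_ne_zero)
    have hsym := eq_reflAt_of_isMax hd0 hfc hmono hu hsol hbound he hyH
      (by simpa using hx.trans hxy) (by simpa [hRy] using hx) (by rw [hRy, heq]) fun z hz => by
        rw [hRy, heq, sub_self]
        exact sub_nonpos.2 (le_reflAt hd0 hfc hmono hu hsol hball hbound hdecay he hlam0.le hz)
    obtain ⟨z, hz, hzne⟩ := exists_ne_reflAt hrad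
      (by rw [hball 0 (by simpa using hr.le)]; exact hA) hdecay he hlam0
    exact hzne (hsym z hz)
  refine ⟨hrad, fun x y hx hxy => ?_⟩
  rcases hx.lt_or_eq with hx | hx
  · exact hstrict x y hx hxy
  · obtain ⟨t, ht₁, ht₂⟩ := exists_between (hx.trans_lt hxy)
    have hy0 : 0 < ‖y‖ := (norm_nonneg x).trans_lt hxy
    have hnorm : ‖(t / ‖y‖) • y‖ = t := by
      rw [norm_smul, norm_div, norm_norm, div_mul_cancel₀ _ hy0.ne',
        Real.norm_of_nonneg (hr.trans ht₁).le]
    have h1 := hstrict ((t / ‖y‖) • y) y (by rwa [hnorm]) (by rwa [hnorm])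
    rw [hball x (by simpa using hx.ge)]
    exact h1.trans_le (hbound _).2
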